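/- arXiv:1907.12497 — 2 statements merged into one kernel-verified Lean document; each statement's English description precedes it below -/
import Mathlib

section
/- Let A be an m-homogeneous supersolvable line arrangement in ℙ² with 3 ≤ m ≤ 5, which is not a pencil, consisting of d = |A| lines. Then n₂ ≥ d/2. -/
open scoped LinearAlgebra.Projectivization
noncomputable section
attribute [local instance] Classical.propDecidable

/-- A point of the complex projective plane. -/
abbrev ProjPoint := ℙ ℂ (Fin 3 → ℂ)

/-- A line of the complex projective plane, encoded by a defining linear form
up to scalar, i.e. as a point of the dual projective plane. -/
abbrev ProjLine := ℙ ℂ (Module.Dual ℂ (Fin 3 → ℂ))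

/-- The incidence relation between points and lines of `ℙ²`. -/
def PointOnLine (p : ProjPoint) (L : ProjLine) : Prop :=
  L.rep p.rep = 0

/-- The multiplicity of a point with respect to a line arrangement:
the number of lines of the arrangement passing through the point. -/
def mult (A : Finset ProjLine) (p : ProjPoint) : ℕ :=
  Set.ncard {L : ProjLine | L ∈ A ∧ PointOnLine p L}

/-- An intersection point of a line arrangement: a point lying on at least two lines. -/
def IsIntersectionPoint (A : Finset ProjLine) (p : ProjPoint) : Prop :=
  2 ≤ mult A p

/-- A modular point: an intersection point `p` such that for any other intersection
point `q`, the line through `p` and `q` belongs to the arrangement. -/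
def IsModular (A : Finset ProjLine) (p : ProjPoint) : Prop :=
  IsIntersectionPoint A p ∧
    ∀ q : ProjPoint, IsIntersectionPoint A q → q ≠ p →
      ∃ L ∈ A, PointOnLine p L ∧ PointOnLine q L

/-- A supersolvable line arrangement: one possessing a modular point. -/
def IsSupersolvable (A : Finset ProjLine) : Prop :=
  ∃ p, IsModular A p

/-- An `m`-homogeneous supersolvable line arrangement: supersolvable, and all
modular points have multiplicity `m`. -/
def IsHomogSS (A : Finset ProjLine) (m : ℕ) : Prop :=
  IsSupersolvable A ∧ ∀ p, IsModular A p → mult A p = m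

/-- `nk A k` is the number of intersection points of multiplicity `k` of `A`. -/
def nk (A : Finset ProjLine) (k : ℕ) : ℕ :=
  Set.ncard {p : ProjPoint | IsIntersectionPoint A p ∧ mult A p = k}

/-- A pencil: all lines pass through a common point. -/
def IsPencil (A : Finset ProjLine) : Prop :=
  ∃ p, ∀ L ∈ A, PointOnLine p L

section SSAlgebra
open Polynomial

/-- The linear polynomial `u x + v`. -/
def linP (u v : ℂ) : ℂ[X] := C u * X + C v

/-- Total degree at most `k` for a polynomial in `y` over `ℂ[x]`. -/
def TotDeg (k : ℕ) (g : ℂ[X][X]) : Prop :=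
  ∀ i j, k < i + j → (g.coeff j).coeff i = 0

lemma linP_eval (u v a : ℂ) : (linP u v).eval a = u * a + v := by simp [linP]

lemma linP_natDegree (u v : ℂ) : (linP u v).natDegree ≤ 1 := by
  unfold linP; exact natDegree_linear_le

lemma linP_derivative (u v : ℂ) : derivative (linP u v) = C u := by simp [linP]

lemma totDeg_eval {k : ℕ} {g : ℂ[X][X]} (h : TotDeg k g) (u v : ℂ) :
    (g.eval (linP u v)).natDegree ≤ k := by
  rw [eval_eq_sum_range]
  refine natDegree_sum_le_of_forall_le _ _ fun j _ => ?_
  by_cases h0 : g.coeff j = 0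
  · simp [h0]
  · have h1 : (g.coeff j).natDegree + j ≤ k := by
      by_contra hc
      exact h0 (leadingCoeff_eq_zero.mp (h _ j (not_le.mp hc)))
    refine natDegree_mul_le.trans ?_
    have h2 : ((linP u v) ^ j).natDegree ≤ j * 1 :=
      natDegree_pow_le_of_le j (linP_natDegree u v)
    omega

lemma totDeg_mul {k : ℕ} {g : ℂ[X][X]} (h : TotDeg k g) (u v : ℂ) :
    TotDeg (k + 1) (g * (X - C (linP u v))) := by
  intro i j hij
  have h2 : ∀ j', k + 1 < i + j' → (g.coeff j' * linP u v).coeff i = 0 := by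
    intro j' hj
    rw [linP, mul_add, ← mul_assoc, coeff_add, coeff_mul_C, h i j' (by omega)]
    cases i with
    | zero => simp
    | succ i => rw [coeff_mul_X, coeff_mul_C, h i j' (by omega)]; simp
  cases j with
  | zero =>
    have := h2 0 hij
    simp only [mul_sub, coeff_sub, mul_coeff_zero, coeff_X_zero, mul_zero,
      this, coeff_zero, coeff_C_zero, sub_zero]
  | succ j =>
    have := h2 (j + 1) hij
    simp only [mul_sub, coeff_sub, coeff_mul_C, coeff_mul_X, this, h i j (by omega), sub_zero]

lemma totDeg_prod {ι : Type*} (D : ℂ[X]) (k : ℕ) (hD : D.natDegree ≤ k) (u v : ι → ℂ)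
    (J : Finset ι) : TotDeg (k + J.card) (C D * ∏ j ∈ J, (X - C (linP (u j) (v j)))) := by
  classical
  induction J using Finset.induction_on with
  | empty =>
    intro i j hij
    simp only [Finset.card_empty, add_zero] at hij
    simp only [Finset.prod_empty, mul_one]
    rw [coeff_C]
    split_ifs with h
    · exact coeff_eq_zero_of_natDegree_lt (by omega)
    · simp
  | insert a J ha ih =>
    rw [Finset.prod_insert ha, Finset.card_insert_of_notMem ha, mul_comm (X - _), ← mul_assoc]
    exact totDeg_mul ih _ _

lemma totDeg_natDegree {k : ℕ} {g : ℂ[X][X]} (h : TotDeg k g) : g.natDegree ≤ k := by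
  rw [natDegree_le_iff_coeff_eq_zero]
  intro j hj
  ext i
  simpa using h i j (by omega)

/-- distinct roots give a product divisor -/
lemma prod_dvd_of_roots {R : Type*} [CommRing R] [IsDomain R] {ι : Type*} (J : Finset ι)
    (f : ι → R) (hf : Set.InjOn f J) (G : R[X]) (hG : ∀ j ∈ J, G.eval (f j) = 0) :
    (∏ j ∈ J, (X - C (f j))) ∣ G := by
  classical
  by_cases h0 : G = 0
  · simp [h0]
  have := (Multiset.prod_X_sub_C_dvd_iff_le_roots h0 ((J.image f).val)).mpr (by
    rw [Multiset.le_iff_subset (Finset.nodup _)]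
    intro x hx
    rw [Finset.mem_val, Finset.mem_image] at hx
    obtain ⟨j, hj, rfl⟩ := hx
    exact (mem_roots h0).mpr (hG j hj))
  have h2 : (Multiset.map (fun a => X - C a) (J.image f).val).prod
      = ∏ j ∈ J, (X - C (f j)) := by
    change ∏ x ∈ J.image f, (X - C x) = _
    rw [Finset.prod_image hf]
  rwa [h2] at this

/-- partial derivative in x -/
lemma exists_dx (g : ℂ[X][X]) : ∃ gx : ℂ[X][X], gx.natDegree ≤ g.natDegree ∧
    ∀ f : ℂ[X], derivative (g.eval f) = gx.eval f + g.derivative.eval f * derivative f := by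
  refine ⟨∑ j ∈ Finset.range (g.natDegree + 1), C (derivative (g.coeff j)) * X ^ j, ?_, ?_⟩
  · refine natDegree_sum_le_of_forall_le _ _ fun j hj => ?_
    refine (natDegree_C_mul_X_pow_le _ _).trans ?_
    have := Finset.mem_range.mp hj
    omega
  · intro f
    rw [derivative_eval, sum_over_range' _ (by simp) (g.natDegree + 1) (by omega),
      eval_eq_sum_range, eval_finsetSum, derivative_sum, Finset.sum_mul,
      ← Finset.sum_add_distrib]
    refine Finset.sum_congr rfl fun j _ => ?_
    simp only [derivative_mul, derivative_pow, eval_mul, eval_C, eval_pow, eval_X, map_natCast]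
    ring

lemma linP_sub {u v u' v' a : ℂ} (h : u * a + v = u' * a + v') :
    linP u v - linP u' v' = C (u - u') * (X - C a) := by
  have : v - v' = -(u - u') * a := by linear_combination h
  have h2 : C v - C v' = (C (-(u - u') * a) : ℂ[X]) := by rw [← C_sub, this]
  simp only [C_mul, C_neg, C_sub] at h2
  simp only [linP, C_sub]
  linear_combination h2

lemma step_dvd {ι : Type*} (u v : ι → ℂ) (hu : Function.Injective u) (S : Finset ℂ)
    (hag : ∀ i j, i ≠ j → ∃ a ∈ S, u i * a + v i = u j * a + v j)
    (J : Finset ι) (i : ι) (hi : i ∉ J) (g : ℂ[X][X])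
    (hg : ∀ j ∈ J, g.eval (linP (u j) (v j)) = C (u j) * ∏ a ∈ S, (X - C a)) :
    (∏ j ∈ J, (linP (u i) (v i) - linP (u j) (v j))) ∣
      C (u i) * ∏ a ∈ S, (X - C a) - g.eval (linP (u i) (v i)) := by
  classical
  have hne : ∀ j ∈ J, i ≠ j := fun j hj h => hi (h ▸ hj)
  have hex : ∀ j, ∃ a, j ∈ J → a ∈ S ∧ u i * a + v i = u j * a + v j := by
    intro j
    by_cases hj : j ∈ J
    · obtain ⟨a, ha, h⟩ := hag i j (hne j hj)
      exact ⟨a, fun _ => ⟨ha, h⟩⟩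
    · exact ⟨0, fun h => absurd h hj⟩
  choose c hc using hex
  rw [← Finset.prod_fiberwise_of_maps_to (s := J) (t := S) (g := c) (fun j hj => (hc j hj).1)]
  refine Finset.prod_dvd_of_coprime ?_ ?_
  · intro a _ b _ hab
    refine IsCoprime.prod_left fun j hj => IsCoprime.prod_right fun k hk => ?_
    simp only [Finset.mem_filter] at hj hk
    have h1 := (hc j hj.1).2
    have h2 := (hc k hk.1).2
    rw [hj.2] at h1
    rw [hk.2] at h2
    rw [linP_sub h1, linP_sub h2]
    have e1 : IsUnit (C (u i - u j)) := isUnit_C.mpr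
      (isUnit_iff_ne_zero.mpr (sub_ne_zero.mpr (fun h => hne j hj.1 (hu h))))
    have e2 : IsUnit (C (u i - u k)) := isUnit_C.mpr
      (isUnit_iff_ne_zero.mpr (sub_ne_zero.mpr (fun h => hne k hk.1 (hu h))))
    rw [isCoprime_mul_unit_left_left e1, isCoprime_mul_unit_left_right e2]
    exact isCoprime_X_sub_C_of_isUnit_sub (isUnit_iff_ne_zero.mpr (sub_ne_zero.mpr hab))
  · intro a ha
    set β : ℂ[X] := ∏ b ∈ S.erase a, (X - C b)
    have hα : ∏ b ∈ S, (X - C b) = (X - C a) * β := (Finset.mul_prod_erase S _ ha).symm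
    set w : ℂ := u i * a + v i with hw
    have hroot := prod_dvd_of_roots (J.filter (fun j => c j = a))
      (fun j => linP (u j) (v j))
      (by
        intro j _ k _ hjk
        have := congrArg derivative hjk
        simp only [linP_derivative] at this
        exact hu (C_injective this))
      (g - C β * (X - C (C w))) (by
        intro j hj
        simp only [Finset.mem_filter] at hj
        have h1 := (hc j hj.1).2
        rw [hj.2] at h1
        simp only [eval_sub, eval_mul, eval_C, eval_X]
        rw [hg j hj.1, hα]
        have h3 : linP (u j) (v j) - C w = C (u j) * (X - C a) := by
          rw [hw, h1]; simp only [linP, C_add, C_mul]; ring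
        rw [h3]; ring)
    have h4 := map_dvd (evalRingHom (linP (u i) (v i))) hroot
    rw [map_prod] at h4
    simp only [coe_evalRingHom, eval_sub, eval_mul, eval_C, eval_X] at h4
    have h3 : linP (u i) (v i) - C w = C (u i) * (X - C a) := by
      rw [hw]; simp only [linP, C_add, C_mul]; ring
    rw [h3] at h4
    rw [hα, ← dvd_neg]
    convert h4 using 1
    ring

lemma exists_gt {ι : Type*} (u v : ι → ℂ) (hu : Function.Injective u) (S : Finset ℂ)
    (hag : ∀ i j, i ≠ j → ∃ a ∈ S, u i * a + v i = u j * a + v j) (k : ℕ)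
    (hS : S.card = k + 1) (J : Finset ι) :
    ∃ g : ℂ[X][X], TotDeg k g ∧
      ∀ j ∈ J, (C (X ^ k) * X + g).eval (linP (u j) (v j)) = C (u j) * ∏ a ∈ S, (X - C a) := by
  classical
  induction J using Finset.induction_on with
  | empty => exact ⟨0, fun i j _ => by simp, by simp⟩
  | insert i J hi ih =>
    obtain ⟨g, hT, hg⟩ := ih
    obtain ⟨D, hD⟩ := step_dvd u v hu S hag J i hi _ hg
    have hmon : (∏ a ∈ S, (X - C a)).Monic := monic_prod_of_monic _ _ fun a _ => monic_X_sub_C a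
    have hdeg : (∏ a ∈ S, (X - C a)).natDegree = k + 1 := by
      rw [natDegree_prod_of_monic _ _ fun a _ => monic_X_sub_C a]; simp [hS]
    have hR : (C (u i) * ∏ a ∈ S, (X - C a) -
        (C (X ^ k) * X + g).eval (linP (u i) (v i))).natDegree ≤ k := by
      have e : C (u i) * ∏ a ∈ S, (X - C a) - (C (X ^ k) * X + g).eval (linP (u i) (v i))
        = C (u i) * (∏ a ∈ S, (X - C a) - X ^ (k + 1)) - C (v i) * X ^ k
          - g.eval (linP (u i) (v i)) := by
        simp only [eval_add, eval_mul, eval_C, eval_X]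
        simp only [linP]
        ring
      rw [e]
      refine (natDegree_sub_le _ _).trans (max_le ((natDegree_sub_le _ _).trans
        (max_le ?_ (natDegree_C_mul_X_pow_le _ _))) (totDeg_eval hT _ _))
      refine (natDegree_C_mul_le _ _).trans ?_
      rw [natDegree_le_iff_coeff_eq_zero]
      intro n hn
      rw [coeff_sub, coeff_X_pow]
      split_ifs with h
      · have := hmon.coeff_natDegree
        rw [hdeg] at this
        rw [h, this, sub_self]
      · rw [coeff_eq_zero_of_natDegree_lt (by omega), sub_zero]
    have hne : ∀ j ∈ J, u i - u j ≠ 0 := fun j hj h => hi (hu (sub_eq_zero.mp h) ▸ hj)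
    have hcoef : ∀ j ∈ J, (linP (u i) (v i) - linP (u j) (v j)).natDegree = 1 := by
      intro j hj
      have : linP (u i) (v i) - linP (u j) (v j) = C (u i - u j) * X + C (v i - v j) := by
        simp only [linP, C_sub]; ring
      rw [this]; exact natDegree_linear (hne j hj)
    have hne0 : ∀ j ∈ J, linP (u i) (v i) - linP (u j) (v j) ≠ 0 := by
      intro j hj h
      have := hcoef j hj
      rw [h] at this; simp at this
    have hPdeg : (∏ j ∈ J, (linP (u i) (v i) - linP (u j) (v j))).natDegree = J.card := by
      rw [natDegree_prod _ _ hne0, Finset.sum_congr rfl hcoef]; simp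
    have hP0 : (∏ j ∈ J, (linP (u i) (v i) - linP (u j) (v j))) ≠ 0 :=
      Finset.prod_ne_zero_iff.mpr hne0
    refine ⟨g + C D * ∏ j ∈ J, (X - C (linP (u j) (v j))), ?_, ?_⟩
    · by_cases hD0 : D = 0
      · simpa [hD0] using hT
      have hdd := congrArg natDegree hD
      rw [natDegree_mul hP0 hD0, hPdeg] at hdd
      have := totDeg_prod D (k - J.card) (by omega) u v J
      rw [Nat.sub_add_cancel (by omega)] at this
      intro a b hab
      rw [coeff_add, coeff_add, hT a b hab, this a b hab, add_zero]
    · intro j hj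
      rw [Finset.mem_insert] at hj
      rw [← add_assoc, eval_add, eval_mul, eval_C, eval_prod]
      simp only [eval_sub, eval_X, eval_C]
      rcases hj with rfl | hj
      · linear_combination -hD
      · rw [Finset.prod_eq_zero hj (sub_self _), mul_zero, add_zero]
        exact hg j hj

lemma exists_g {ι : Type*} [Fintype ι] (u v : ι → ℂ) (hu : Function.Injective u) (S : Finset ℂ)
    (hag : ∀ i j, i ≠ j → ∃ a ∈ S, u i * a + v i = u j * a + v j) (k : ℕ) (hk : 1 ≤ k)
    (hS : S.card = k + 1) :
    ∃ g : ℂ[X][X], g.natDegree ≤ k ∧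
      ∀ j, g.eval (linP (u j) (v j)) = C (u j) * ∏ a ∈ S, (X - C a) := by
  obtain ⟨g, hT, hg⟩ := exists_gt u v hu S hag k hS Finset.univ
  refine ⟨_, ?_, fun j => hg j (Finset.mem_univ j)⟩
  refine natDegree_add_le_of_degree_le ?_ (totDeg_natDegree hT)
  have := natDegree_C_mul_X_pow_le (X ^ k : ℂ[X]) 1
  rw [pow_one] at this
  omega

lemma deriv_alpha_ne (S : Finset ℂ) (a : ℂ) (ha : a ∈ S) :
    (derivative (∏ b ∈ S, (X - C b))).eval a ≠ 0 := by
  classical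
  rw [← Finset.mul_prod_erase S _ ha, derivative_mul]
  simp only [eval_add, eval_mul, derivative_X_sub_C, one_mul, eval_sub, eval_X, eval_C,
    sub_self, zero_mul, add_zero, eval_prod]
  refine Finset.prod_ne_zero_iff.mpr fun b hb => sub_ne_zero.mpr fun h => ?_
  exact (Finset.ne_of_mem_erase hb) h.symm

/-- Main algebraic lemma: either all lines are concurrent at some `a ∈ S`, or the number of lines
is at most `2 |S| - 3`, and in case of equality each fiber has at least `|S| - 1` values. -/
lemma main_alg {ι : Type*} [Fintype ι] (u v : ι → ℂ) (hu : Function.Injective u) (S : Finset ℂ)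
    (hag : ∀ i j, i ≠ j → ∃ a ∈ S, u i * a + v i = u j * a + v j) (k : ℕ) (hk : 1 ≤ k)
    (hS : S.card = k + 1)
    (hnc : ¬ ∃ a ∈ S, ∀ i j, u i * a + v i = u j * a + v j) :
    Fintype.card ι ≤ 2 * k - 1 ∧ (Fintype.card ι = 2 * k - 1 → ∀ a ∈ S,
      k ≤ (Finset.univ.image (fun i => u i * a + v i)).card) := by
  classical
  obtain ⟨g, hgd, hg⟩ := exists_g u v hu S hag k hk hS
  obtain ⟨gx, hgxd, hgx⟩ := exists_dx g
  set α : ℂ[X] := ∏ a ∈ S, (X - C a) with hα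
  have hα0 : α ≠ 0 := (monic_prod_of_monic _ _ fun a _ => monic_X_sub_C a).ne_zero
  set f : ι → ℂ[X] := fun j => linP (u j) (v j) with hf
  have hfinj : Function.Injective f := by
    intro j l hjl
    have := congrArg derivative hjl
    simp only [hf, linP_derivative] at this
    exact hu (C_injective this)
  have hder : ∀ j, gx.eval (f j) + g.derivative.eval (f j) * C (u j)
      = C (u j) * derivative α := by
    intro j
    have h1 := hgx (f j)
    rw [show g.eval (f j) = C (u j) * α from hg j] at h1
    simp only [hf, linP_derivative, derivative_mul, derivative_C, zero_mul, zero_add] at h1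
    exact h1.symm
  -- `g` has degree at least two in `y`
  have hr2 : 2 ≤ g.natDegree := by
    by_contra hlt
    have hg1 : g.natDegree ≤ 1 := by omega
    obtain ⟨b1, b0, hb⟩ := exists_eq_X_add_C_of_natDegree_le_one hg1
    have hlin : ∀ i j, C (u i - u j) * α = b1 * (f i - f j) := by
      intro i j
      have h1 := hg i
      have h2 := hg j
      rw [hb] at h1 h2
      simp only [eval_add, eval_mul, eval_C, eval_X] at h1 h2
      simp only [hf, C_sub]
      linear_combination h2 - h1
    have hb1 : ∀ i j a, i ≠ j → u i * a + v i = u j * a + v j → α = b1 * (X - C a) := by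
      intro i j a hij h
      have h1 := hlin i j
      simp only [hf] at h1
      rw [linP_sub h] at h1
      have h0 : (C (u i - u j) : ℂ[X]) ≠ 0 :=
        C_ne_zero.mpr (sub_ne_zero.mpr (fun h => hij (hu h)))
      apply mul_left_cancel₀ h0
      rw [h1]; ring
    have hb10 : ∀ i j : ι, i ≠ j → b1 ≠ 0 := by
      intro i j hij h
      obtain ⟨a, _, h'⟩ := hag i j hij
      have := hb1 i j a hij h'
      rw [h, zero_mul] at this
      exact hα0 this
    apply hnc
    by_cases hsub : ∃ i j : ι, i ≠ j
    · obtain ⟨i, j, hij⟩ := hsub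
      obtain ⟨a, ha, h⟩ := hag i j hij
      refine ⟨a, ha, fun i' j' => ?_⟩
      by_cases hij' : i' = j'
      · rw [hij']
      obtain ⟨a', ha', h'⟩ := hag i' j' hij'
      have e1 := hb1 i j a hij h
      have e2 := hb1 i' j' a' hij' h'
      have e3 := mul_left_cancel₀ (hb10 i j hij) (e1.symm.trans e2)
      have e4 : a = a' := by
        have := congrArg (eval a') e3
        simp only [eval_sub, eval_X, eval_C, sub_self] at this
        exact (sub_eq_zero.mp this).symm
      rw [e4]; exact h'
    · push Not at hsub
      obtain ⟨a, ha⟩ : S.Nonempty := Finset.card_pos.mp (by omega)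
      exact ⟨a, ha, fun i j => by rw [hsub i j]⟩
  set r := g.natDegree with hr
  set H : ℂ[X][X] := C α * gx - C (derivative α) * g + derivative g * g with hH
  have hHroot : ∀ j, H.eval (f j) = 0 := by
    intro j
    simp only [hH, eval_add, eval_sub, eval_mul, eval_C]
    rw [show g.eval (f j) = C (u j) * α from hg j]
    linear_combination α * hder j
  have hHdeg : H.natDegree ≤ 2 * r - 1 := by
    refine (natDegree_add_le _ _).trans (max_le ((natDegree_sub_le _ _).trans (max_le ?_ ?_)) ?_)
    · exact (natDegree_C_mul_le _ _).trans (by omega)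
    · exact (natDegree_C_mul_le _ _).trans (by omega)
    · have := natDegree_derivative_le g
      exact natDegree_mul_le.trans (by omega)
  have hHcoef : H.coeff (2 * r - 1) = r * g.leadingCoeff ^ 2 := by
    have e1 : (C α * gx).coeff (2 * r - 1) = 0 := by
      rw [coeff_C_mul, coeff_eq_zero_of_natDegree_lt (by omega), mul_zero]
    have e2 : (C (derivative α) * g).coeff (2 * r - 1) = 0 := by
      rw [coeff_C_mul, coeff_eq_zero_of_natDegree_lt (by omega), mul_zero]
    have e3 : (derivative g * g).coeff (2 * r - 1) = r * g.leadingCoeff ^ 2 := by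
      have h1 : 2 * r - 1 = (r - 1) + r := by omega
      rw [h1, coeff_mul_add_eq_of_natDegree_le (natDegree_derivative_le g) le_rfl, coeff_derivative]
      have h2 : r - 1 + 1 = r := by omega
      rw [h2, coeff_natDegree]
      have h3 : ((r - 1 : ℕ) : ℂ[X]) + 1 = (r : ℂ[X]) := by
        rw [← h2]; push_cast; simp
      rw [h3]; ring
    rw [hH, coeff_add, coeff_sub, e1, e2, e3]; ring
  have hg0 : g ≠ 0 := by
    intro h
    rw [hr, h, natDegree_zero] at hr2
    omega
  have hlc : (r : ℂ[X]) * g.leadingCoeff ^ 2 ≠ 0 :=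
    mul_ne_zero (Nat.cast_ne_zero.mpr (by omega)) (pow_ne_zero _ (leadingCoeff_ne_zero.mpr hg0))
  have hH0 : H ≠ 0 := by
    intro h
    rw [h, coeff_zero] at hHcoef
    exact hlc hHcoef.symm
  obtain ⟨Q, hQ⟩ := prod_dvd_of_roots Finset.univ f hfinj.injOn H (fun j _ => hHroot j)
  have hPm : (∏ j : ι, (X - C (f j))).Monic := monic_prod_of_monic _ _ fun j _ => monic_X_sub_C _
  have hPd : (∏ j : ι, (X - C (f j))).natDegree = Fintype.card ι := by
    rw [natDegree_prod_of_monic _ _ fun a _ => monic_X_sub_C _]; simp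
  have hQ0 : Q ≠ 0 := by
    rintro rfl
    rw [mul_zero] at hQ
    exact hH0 hQ
  have hdeg : H.natDegree = Fintype.card ι + Q.natDegree := by
    rw [hQ, hPm.natDegree_mul' hQ0, hPd]
  refine ⟨by omega, fun hcard a ha => ?_⟩
  have hrk : r = k := by omega
  have hQd : Q.natDegree = 0 := by omega
  obtain ⟨q, rfl⟩ := natDegree_eq_zero.mp hQd
  have hq : q = r * g.leadingCoeff ^ 2 := by
    rw [← hHcoef, hQ, coeff_mul_C]
    have := hPm.coeff_natDegree
    rw [hPd, hcard, ← hrk] at this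
    rw [this, one_mul]
  -- restrict to the fiber at `a`
  set e := evalRingHom a with he
  set gb : ℂ[X] := g.map e with hgb
  set w : ι → ℂ := fun i => u i * a + v i with hw
  have hfe : ∀ i, e (f i) = w i := by
    intro i; simp [he, hf, hw, linP_eval]
  set δ : ℂ := (derivative α).eval a with hδ
  have hδ0 : δ ≠ 0 := deriv_alpha_ne S a ha
  have hαa : e α = 0 := by
    simp only [he, hα, coe_evalRingHom, eval_prod]
    exact Finset.prod_eq_zero ha (by simp)
  have hev : ∀ (p : ℂ[X][X]) i, (p.map e).eval (w i) = e (p.eval (f i)) := by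
    intro p i
    rw [← hfe i, eval_map, eval₂_hom]
  have hgroot : ∀ i, gb.eval (w i) = 0 := by
    intro i
    rw [hgb, hev, show g.eval (f i) = C (u i) * α from hg i, map_mul, hαa, mul_zero]
  have hpair : ∀ i j, i ≠ j → w i = w j → (derivative gb).eval (w i) = δ := by
    intro i j hij hwij
    have h1 := congrArg e (hder i)
    have h2 := congrArg e (hder j)
    rw [map_add, map_mul, map_mul, ← hev, ← hev, ← derivative_map] at h1 h2
    rw [← hwij] at h2
    have hC : ∀ c : ℂ, e (C c) = c := fun c => by simp [he]
    rw [hC] at h1 h2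
    have hd : e (derivative α) = δ := rfl
    rw [hd] at h1 h2
    have h0 : u i - u j ≠ 0 := sub_ne_zero.mpr fun h => hij (hu h)
    apply mul_left_cancel₀ h0
    linear_combination h1 - h2
  have hHb : gb * (derivative gb - C δ) = (∏ j : ι, (X - C (w j))) * C (e q) := by
    have h1 := congrArg (Polynomial.map e) hQ
    rw [hH] at h1
    simp only [Polynomial.map_add, Polynomial.map_sub, Polynomial.map_mul, map_C, hαa,
      Polynomial.map_prod, map_X, hfe] at h1
    rw [← derivative_map] at h1
    rw [← h1]
    have hd : e (derivative α) = δ := rfl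
    rw [hd, C_0]
    ring
  have heq : e q = r * (gb.coeff r) ^ 2 := by
    rw [hq, hgb, coeff_map, map_mul, map_pow, map_natCast]; rfl
  by_cases hz : gb.coeff r = 0
  · rw [heq, hz] at hHb
    have h0 : gb * (derivative gb - C δ) = 0 := by rw [hHb]; simp
    rcases mul_eq_zero.mp h0 with h1 | h1
    · have hinj : Function.Injective w := by
        intro i j hij
        by_contra hne
        have := hpair i j hne hij
        rw [h1] at this
        simp at this
        exact hδ0 this.symm
      rw [Finset.card_image_of_injective _ hinj, Finset.card_univ]
      omega
    · exfalso
      apply hnc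
      refine ⟨a, ha, fun i j => ?_⟩
      have h2 : derivative (gb - C δ * X) = 0 := by
        rw [derivative_sub, derivative_C_mul, derivative_X, mul_one]; exact h1
      have h3 := derivative_eq_zero.mp h2
      obtain ⟨c, hc⟩ := natDegree_eq_zero.mp h3
      have h4 : gb = C δ * X + C c := by rw [hc]; ring
      have h5 := hgroot i
      have h6 := hgroot j
      rw [h4] at h5 h6
      simp only [eval_add, eval_mul, eval_C, eval_X] at h5 h6
      apply mul_left_cancel₀ hδ0
      linear_combination h5 - h6
  · have hgbd : gb.natDegree = r := natDegree_eq_of_le_of_coeff_ne_zero natDegree_map_le hz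
    have hgb0 : gb ≠ 0 := by
      rintro h
      rw [h] at hz; simp at hz
    have heq0 : e q ≠ 0 := by
      rw [heq]
      exact mul_ne_zero (Nat.cast_ne_zero.mpr (by omega)) (pow_ne_zero _ hz)
    have hrt : ∀ y, gb.eval y = 0 → ∃ i, w i = y := by
      intro y hy
      have h1 := congrArg (eval y) hHb
      rw [eval_mul, hy, zero_mul, eval_mul, eval_C, eval_prod] at h1
      have h2 := (mul_eq_zero.mp h1.symm).resolve_right heq0
      obtain ⟨i, _, hi⟩ := Finset.prod_eq_zero_iff.mp h2
      refine ⟨i, ?_⟩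
      simp only [eval_sub, eval_X, eval_C] at hi
      exact (sub_eq_zero.mp hi).symm
    have hsimple : ∀ y, gb.eval y = 0 → (derivative gb).eval y ≠ 0 := by
      intro y hy hy'
      obtain ⟨i, rfl⟩ := hrt y hy
      have huniq : ∀ j, j ≠ i → w i - w j ≠ 0 := by
        intro j hj h
        have := hpair i j hj.symm (sub_eq_zero.mp h)
        rw [hy'] at this
        exact hδ0 this.symm
      have h1 := congrArg (fun p => (derivative p).eval (w i)) hHb
      rw [← Finset.mul_prod_erase Finset.univ _ (Finset.mem_univ i)] at h1
      simp only [derivative_mul, eval_add, eval_mul, hy, hy', zero_mul, derivative_X_sub_C,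
        one_mul, eval_sub, eval_X, eval_C, sub_self, derivative_C, mul_zero, add_zero,
        eval_prod] at h1
      refine mul_ne_zero (Finset.prod_ne_zero_iff.mpr fun j hj => ?_) heq0 h1.symm
      exact huniq j (Finset.ne_of_mem_erase hj)
    have hnodup : gb.roots.Nodup := by
      rw [Multiset.nodup_iff_count_le_one]
      intro y
      rw [count_roots]
      by_contra hlt
      have h1 := (one_lt_rootMultiplicity_iff_isRoot hgb0).mp (not_le.mp hlt)
      exact hsimple y h1.1 h1.2
    have hcardr : gb.roots.card = r := by
      rw [← hgbd]; exact (IsAlgClosed.card_roots_eq_natDegree)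
    rw [← hrk, ← hcardr, ← Multiset.toFinset_card_of_nodup hnodup]
    refine Finset.card_le_card fun y hy => ?_
    rw [Multiset.mem_toFinset, mem_roots hgb0] at hy
    obtain ⟨i, hi⟩ := hrt y hy
    exact Finset.mem_image.mpr ⟨i, Finset.mem_univ i, hi⟩

end SSAlgebra

section SSComb

/-- number of lines `y = u i * x + v i` through the affine point `p` -/
def cls {ι : Type*} [Fintype ι] (u v : ι → ℂ) (p : ℂ × ℂ) : ℕ :=
  (Finset.univ.filter (fun i => u i * p.1 + v i = p.2)).card

/-- points of the lines over `S` -/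
def pts {ι : Type*} [Fintype ι] (u v : ι → ℂ) (S : Finset ℂ) : Finset (ℂ × ℂ) :=
  (S ×ˢ (Finset.univ : Finset ι)).image (fun x => (x.1, u x.2 * x.1 + v x.2))

lemma agree_unique {ι : Type*} (u v : ι → ℂ) (hu : Function.Injective u) {i j : ι} (hij : i ≠ j)
    {a b : ℂ} (ha : u i * a + v i = u j * a + v j) (hb : u i * b + v i = u j * b + v j) :
    a = b := by
  have h0 : u i - u j ≠ 0 := sub_ne_zero.mpr fun h => hij (hu h)
  apply mul_left_cancel₀ h0
  linear_combination ha - hb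

variable {ι : Type*} [Fintype ι] (u v : ι → ℂ) (S : Finset ℂ)

lemma mem_pts {p : ℂ × ℂ} : p ∈ pts u v S ↔ p.1 ∈ S ∧ ∃ i, u i * p.1 + v i = p.2 := by
  unfold pts
  rw [Finset.mem_image]
  constructor
  · rintro ⟨⟨a, i⟩, h, rfl⟩
    rw [Finset.mem_product] at h
    exact ⟨h.1, i, rfl⟩
  · rintro ⟨h, i, hi⟩
    refine ⟨(p.1, i), Finset.mem_product.mpr ⟨h, Finset.mem_univ _⟩, ?_⟩
    exact Prod.ext rfl hi

lemma cls_pos {p : ℂ × ℂ} (hp : p ∈ pts u v S) : 1 ≤ cls u v p := by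
  obtain ⟨_, i, hi⟩ := (mem_pts u v S).mp hp
  exact Finset.card_pos.mpr ⟨i, by simpa using hi⟩

lemma fib_card {p : ℂ × ℂ} (hp : p.1 ∈ S) :
    ((S ×ˢ (Finset.univ : Finset ι)).filter
      (fun x => (x.1, u x.2 * x.1 + v x.2) = p)).card = cls u v p := by
  symm
  refine Finset.card_bij (fun i _ => (p.1, i)) ?_ ?_ ?_
  · intro i hi
    simp only [Finset.mem_filter, Finset.mem_univ, true_and] at hi
    simp only [Finset.mem_filter, Finset.mem_product, Finset.mem_univ, and_true]
    exact ⟨hp, Prod.ext rfl hi⟩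
  · intro i _ j _ h
    exact (Prod.ext_iff.mp h).2
  · rintro ⟨a, i⟩ h
    simp only [Finset.mem_filter, Finset.mem_product, Finset.mem_univ, and_true] at h
    obtain ⟨_, rfl⟩ := h
    exact ⟨i, by simp, rfl⟩

lemma sum_pts (ψ : ℂ × ℂ → ℕ) :
    ∑ p ∈ pts u v S, cls u v p * ψ p = ∑ i, ∑ a ∈ S, ψ (a, u i * a + v i) := by
  rw [Finset.sum_comm, ← Finset.sum_product (s := S) (t := Finset.univ)
    (f := fun x => ψ (x.1, u x.2 * x.1 + v x.2))]
  have := Finset.sum_comp (s := S ×ˢ (Finset.univ : Finset ι)) ψ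
    (fun x => (x.1, u x.2 * x.1 + v x.2))
  rw [this]
  refine Finset.sum_congr rfl fun p hp => ?_
  rw [fib_card u v S ((mem_pts u v S).mp hp).1, smul_eq_mul]

lemma sum_cls : ∑ p ∈ pts u v S, cls u v p = Fintype.card ι * S.card := by
  have := sum_pts u v S (fun _ => 1)
  simpa using this

lemma sum_line (hu : Function.Injective u)
    (hag : ∀ i j, i ≠ j → ∃ a ∈ S, u i * a + v i = u j * a + v j) (i : ι) :
    ∑ a ∈ S, cls u v (a, u i * a + v i) + 1 = S.card + Fintype.card ι := by
  have h1 : ∀ a, cls u v (a, u i * a + v i) =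
      ∑ j, if u j * a + v j = u i * a + v i then 1 else 0 := by
    intro a; simp [cls]
  simp_rw [h1]
  rw [Finset.sum_comm, ← Finset.add_sum_erase _ _ (Finset.mem_univ i)]
  have h2 : ∀ j ∈ Finset.univ.erase i,
      (∑ a ∈ S, if u j * a + v j = u i * a + v i then 1 else 0) = 1 := by
    intro j hj
    have hne := Finset.ne_of_mem_erase hj
    obtain ⟨a, ha, h⟩ := hag j i hne
    rw [Finset.sum_eq_single a]
    · simp [h]
    · intro b _ hb
      rw [if_neg]
      intro hc
      exact hb (agree_unique u v hu hne hc h)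
    · intro h; exact absurd ha h
  rw [Finset.sum_congr rfl h2]
  have : 0 < Fintype.card ι := Fintype.card_pos_iff.mpr ⟨i⟩
  simp [Finset.card_erase_of_mem, Finset.card_univ]
  omega

lemma sum_sq (hu : Function.Injective u)
    (hag : ∀ i j, i ≠ j → ∃ a ∈ S, u i * a + v i = u j * a + v j) :
    ∑ p ∈ pts u v S, (cls u v p) * (cls u v p) + Fintype.card ι
      = Fintype.card ι * (S.card + Fintype.card ι) := by
  rw [sum_pts u v S (cls u v)]
  have : ∑ i : ι, (∑ a ∈ S, cls u v (a, u i * a + v i) + 1)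
      = ∑ i : ι, (S.card + Fintype.card ι) :=
    Finset.sum_congr rfl fun i _ => sum_line u v S hu hag i
  rw [Finset.sum_add_distrib] at this
  simpa [Finset.card_univ] using this

lemma card_pts : (pts u v S).card = ∑ a ∈ S, (Finset.univ.image (fun i => u i * a + v i)).card := by
  rw [Finset.card_eq_sum_card_fiberwise (f := Prod.fst) (t := S)
    (fun p hp => ((mem_pts u v S).mp hp).1)]
  refine Finset.sum_congr rfl fun a ha => ?_
  symm
  refine Finset.card_bij (fun w _ => (a, w)) ?_ ?_ ?_
  · intro w hw
    rw [Finset.mem_image] at hw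
    obtain ⟨i, _, hi⟩ := hw
    rw [Finset.mem_filter, mem_pts]
    exact ⟨⟨ha, i, hi⟩, rfl⟩
  · intro w _ w' _ h; exact (Prod.ext_iff.mp h).2
  · rintro ⟨b, w⟩ h
    rw [Finset.mem_filter, mem_pts] at h
    obtain ⟨⟨_, i, hi⟩, rfl⟩ := h
    exact ⟨w, Finset.mem_image.mpr ⟨i, Finset.mem_univ _, hi⟩, rfl⟩

/-- No arrangement with only double classes and `n = m + 1` (characteristic not two). -/
lemma no_factorization (hu : Function.Injective u)
    (hag : ∀ i j, i ≠ j → ∃ a ∈ S, u i * a + v i = u j * a + v j)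
    (hcard : Fintype.card ι = S.card + 1) (h3 : 3 ≤ Fintype.card ι)
    (h2 : ∀ p ∈ pts u v S, cls u v p ≤ 2) : False := by
  choose! c hcS hc using hag
  have key : ∀ i i', i ≠ i' → ∏ j ∈ Finset.univ.erase i, (u i - u j)
      = - ∏ j ∈ Finset.univ.erase i', (u i' - u j) := by
    have half : ∀ i i', i ≠ i' →
        (∏ j ∈ Finset.univ.erase i, (u i - u j)) * ∏ b ∈ S.erase (c i i'), (c i i' - b)
        = (u i - u i') * ∏ j ∈ (Finset.univ.erase i).erase i',
            ((u i * c i i' + v i) - (u j * c i i' + v j)) := by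
      intro i i' hii
      have hmem : i' ∈ Finset.univ.erase i := Finset.mem_erase.mpr ⟨hii.symm, Finset.mem_univ _⟩
      rw [← Finset.mul_prod_erase _ _ hmem, mul_assoc]
      congr 1
      have hinj : Set.InjOn (c i) (Finset.univ.erase i : Finset ι) := by
        intro j hj k hk hjk
        by_contra hne
        have hj' := Finset.ne_of_mem_erase (Finset.mem_coe.mp hj)
        have hk' := Finset.ne_of_mem_erase (Finset.mem_coe.mp hk)
        have e1 := hc i j hj'.symm
        have e2 := hc i k hk'.symm
        rw [← hjk] at e2
        have h := h2 (c i j, u i * c i j + v i)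
          ((mem_pts u v S).mpr ⟨hcS i j hj'.symm, i, rfl⟩)
        have hsub : ({i, j, k} : Finset ι) ⊆ Finset.univ.filter
            (fun l => u l * (c i j) + v l = u i * c i j + v i) := by
          intro l hl
          simp only [Finset.mem_insert, Finset.mem_singleton] at hl
          simp only [Finset.mem_filter, Finset.mem_univ, true_and]
          rcases hl with rfl | rfl | rfl
          · rfl
          · exact e1.symm
          · exact e2.symm
        have h4 := Finset.card_le_card hsub
        rw [Finset.card_eq_three.mpr ⟨i, j, k, hj'.symm, hk'.symm, hne, rfl⟩] at h4
        unfold cls at h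
        simp only at h
        omega
      have himg : ((Finset.univ.erase i).erase i').image (c i) = S.erase (c i i') := by
        apply Finset.eq_of_subset_of_card_le
        · intro b hb
          rw [Finset.mem_image] at hb
          obtain ⟨j, hj, rfl⟩ := hb
          have hj1 := Finset.mem_of_mem_erase hj
          have hj2 := Finset.ne_of_mem_erase hj
          refine Finset.mem_erase.mpr ⟨fun h => hj2 (hinj hj1 hmem h), ?_⟩
          exact hcS i j (Finset.ne_of_mem_erase hj1).symm
        · rw [Finset.card_image_of_injOn
            (hinj.mono (Finset.coe_subset.mpr (Finset.erase_subset _ _))),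
            Finset.card_erase_of_mem (hcS i i' hii), Finset.card_erase_of_mem hmem,
            Finset.card_erase_of_mem (Finset.mem_univ i), Finset.card_univ]
          omega
      rw [← himg, Finset.prod_image
        (hinj.mono (Finset.coe_subset.mpr (Finset.erase_subset _ _))), ← Finset.prod_mul_distrib]
      refine Finset.prod_congr rfl fun j hj => ?_
      have hj1 := (Finset.ne_of_mem_erase (Finset.mem_of_mem_erase hj)).symm
      linear_combination -hc i j hj1
    intro i i' hii
    have hcc : c i' i = c i i' :=
      agree_unique u v hu hii (hc i' i hii.symm).symm (hc i i' hii)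
    have e1 := half i i' hii
    have e2 := half i' i hii.symm
    rw [hcc, ← hc i i' hii, Finset.erase_right_comm] at e2
    have hβ : ∏ b ∈ S.erase (c i i'), (c i i' - b) ≠ 0 :=
      Finset.prod_ne_zero_iff.mpr fun b hb =>
        sub_ne_zero.mpr (Finset.ne_of_mem_erase hb).symm
    apply mul_right_cancel₀ hβ
    linear_combination e1 + e2
  obtain ⟨i, j, k, hij, hik, hjk⟩ := Fintype.two_lt_card_iff.mp h3
  have hw : ∏ l ∈ Finset.univ.erase i, (u i - u l) ≠ 0 :=
    Finset.prod_ne_zero_iff.mpr fun l hl =>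
      sub_ne_zero.mpr fun h => (Finset.ne_of_mem_erase hl) (hu h).symm
  apply hw
  have a1 := key i j hij
  have a2 := key j k hjk
  have a3 := key i k hik
  linear_combination (a1 + a3 - a2) / 2

lemma comb_main (hu : Function.Injective u)
    (hag : ∀ i j, i ≠ j → ∃ a ∈ S, u i * a + v i = u j * a + v j)
    (hS3 : 3 ≤ S.card) (hS5 : S.card ≤ 5) (hn : 1 ≤ Fintype.card ι) :
    Fintype.card ι + S.card ≤ 2 * ((pts u v S).filter (fun p => cls u v p = 1)).card := by
  set n := Fintype.card ι with hnn
  set m := S.card with hmm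
  set P := pts u v S with hP
  by_cases hconc : ∃ a ∈ S, ∀ i j, u i * a + v i = u j * a + v j
  · obtain ⟨a, ha, hall⟩ := hconc
    have hsub : (((S.erase a) ×ˢ (Finset.univ : Finset ι)).image
        (fun x => (x.1, u x.2 * x.1 + v x.2))) ⊆ P.filter (fun p => cls u v p = 1) := by
      intro p hp
      rw [Finset.mem_image] at hp
      obtain ⟨⟨b, i⟩, hb, rfl⟩ := hp
      rw [Finset.mem_product] at hb
      have hb1 : b ∈ S.erase a := hb.1
      rw [Finset.mem_filter]
      refine ⟨(mem_pts u v S).mpr ⟨Finset.mem_of_mem_erase hb1, i, rfl⟩, ?_⟩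
      unfold cls
      rw [Finset.card_eq_one]
      refine ⟨i, ?_⟩
      ext j
      simp only [Finset.mem_filter, Finset.mem_univ, true_and, Finset.mem_singleton]
      constructor
      · intro h
        by_contra hne
        exact (Finset.ne_of_mem_erase hb1) (agree_unique u v hu hne h (hall j i))
      · rintro rfl; rfl
    have h1 := Finset.card_le_card hsub
    rw [Finset.card_image_of_injOn, Finset.card_product, Finset.card_erase_of_mem ha,
      Finset.card_univ, ← hmm, ← hnn] at h1
    · obtain ⟨m', hm'⟩ : ∃ m', m = m' + 3 := ⟨m - 3, by omega⟩
      rw [hm'] at h1 ⊢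
      have : (m' + 3 - 1) * n = m' * n + 2 * n := by
        rw [show m' + 3 - 1 = m' + 2 by omega]; ring
      rw [this] at h1
      have : m' * 1 ≤ m' * n := Nat.mul_le_mul_left _ hn
      omega
    · rintro ⟨b, i⟩ hb ⟨b', j⟩ _ h
      simp only [Prod.mk.injEq] at h
      obtain ⟨rfl, h⟩ := h
      have hb1 : b ∈ S.erase a := (Finset.mem_product.mp (Finset.mem_coe.mp hb)).1
      by_contra hne
      have hij : i ≠ j := fun h => hne (by rw [h])
      exact (Finset.ne_of_mem_erase hb1) (agree_unique u v hu hij h (hall i j))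
  · obtain ⟨hb1, hb2⟩ := main_alg u v hu S hag (m - 1) (by omega) (by omega) hconc
    rw [← hnn] at hb1 hb2
    have hs1 : (∑ p ∈ P, (cls u v p : ℤ)) = n * m := by
      have := sum_cls u v S
      exact_mod_cast this
    have hs2 : (∑ p ∈ P, ((cls u v p : ℤ)) ^ 2) = n * (m + n) - n := by
      have := sum_sq u v S hu hag
      have h' : (∑ p ∈ P, ((cls u v p : ℤ)) * (cls u v p : ℤ)) + n = n * (m + n) := by
        exact_mod_cast this
      simp_rw [pow_two]
      linarith
    have hN : (((P.filter (fun p => cls u v p = 1)).card : ℕ) : ℤ)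
        = ∑ p ∈ P, (if cls u v p = 1 then (1 : ℤ) else 0) := by
      simp
    set N := (P.filter (fun p => cls u v p = 1)).card with hNdef
    have hT0 : ∑ p ∈ P, ((if cls u v p = 1 then (1 : ℤ) else 0)
        - (cls u v p : ℤ) * (2 - cls u v p)) = N - n * (m + 1 - n) := by
      have : ∀ p ∈ P, ((if cls u v p = 1 then (1 : ℤ) else 0)
        - (cls u v p : ℤ) * (2 - cls u v p)) = (if cls u v p = 1 then (1 : ℤ) else 0)
          + (cls u v p : ℤ) ^ 2 - 2 * (cls u v p : ℤ) := by
        intro p _; ring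
      rw [Finset.sum_congr rfl this, Finset.sum_sub_distrib, Finset.sum_add_distrib,
        ← Finset.mul_sum, hs1, hs2, ← hN]
      ring
    have hT : ∀ p ∈ P, 0 ≤ ((if cls u v p = 1 then (1 : ℤ) else 0)
        - (cls u v p : ℤ) * (2 - cls u v p)) := by
      intro p hp
      have h1 := cls_pos u v S hp
      split_ifs with h
      · rw [h]; norm_num
      · have h2 : (2 : ℤ) ≤ cls u v p := by
          have : 2 ≤ cls u v p := by omega
          exact_mod_cast this
        nlinarith
    have hB : (n : ℤ) * (m + 1 - n) ≤ N := by
      have := Finset.sum_nonneg hT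
      rw [hT0] at this
      linarith
    -- bound coming from the number of classes
    have hlt : ∀ p ∈ P, cls u v p ≤ n - 1 := by
      intro p hp
      have hp' := (mem_pts u v S).mp hp
      have hle : cls u v p ≤ n := Finset.card_le_univ _
      by_contra hc
      have heq : cls u v p = Fintype.card ι := by omega
      have huniv := Finset.card_eq_iff_eq_univ _ |>.mp heq
      apply hconc
      refine ⟨p.1, hp'.1, fun i j => ?_⟩
      have hi : i ∈ Finset.univ.filter (fun i => u i * p.1 + v i = p.2) := by
        rw [huniv]; exact Finset.mem_univ i
      have hj : j ∈ Finset.univ.filter (fun i => u i * p.1 + v i = p.2) := by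
        rw [huniv]; exact Finset.mem_univ j
      simp only [Finset.mem_filter, Finset.mem_univ, true_and] at hi hj
      rw [hi, hj]
    have hC : n = 2 * (m - 1) - 1 → 5 ≤ n →
        ((n : ℤ) - 2) * N ≥ n * (m + n) - n - (n + 1) * (n * m) + 2 * (n - 1) * (m * (m - 1)) := by
      intro hn' hn5
      have hcp : m * (m - 1) ≤ P.card := by
        rw [hP, card_pts]
        calc m * (m - 1) = ∑ a ∈ S, (m - 1) := by simp [hmm]
          _ ≤ _ := Finset.sum_le_sum fun a ha => hb2 hn' a ha
      have hcp' : (m : ℤ) * (m - 1) ≤ P.card := by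
        have e : ((m * (m - 1) : ℕ) : ℤ) = m * (m - 1) := by
          rw [Nat.cast_mul, Nat.cast_sub (by omega)]; simp
        rw [← e]; exact_mod_cast hcp
      have hterm : ∀ p ∈ P, ((cls u v p : ℤ)) ^ 2 - (n + 1) * (cls u v p) + 2 * (n - 1)
          ≤ ((n : ℤ) - 2) * (if cls u v p = 1 then (1 : ℤ) else 0) := by
        intro p hp
        have h1 := cls_pos u v S hp
        have h2 := hlt p hp
        split_ifs with h
        · rw [h]; push_cast; linarith
        · have h3 : (2 : ℤ) ≤ cls u v p := by
            have : 2 ≤ cls u v p := by omega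
            exact_mod_cast this
          have h4 : (cls u v p : ℤ) ≤ n - 1 := by
            have : cls u v p + 1 ≤ n := by omega
            have : (cls u v p : ℤ) + 1 ≤ n := by exact_mod_cast this
            linarith
          nlinarith
      have := Finset.sum_le_sum hterm
      rw [Finset.sum_add_distrib, Finset.sum_sub_distrib, ← Finset.mul_sum, ← Finset.mul_sum,
        ← Finset.mul_sum, ← hN, hs1, hs2, Finset.sum_const, nsmul_eq_mul] at this
      have hn1 : (0 : ℤ) ≤ 2 * (n - 1) := by
        have : (1 : ℤ) ≤ n := by exact_mod_cast hn
        linarith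
      nlinarith [mul_le_mul_of_nonneg_left hcp' hn1]
    -- the exceptional case
    have hE : m = 5 → n = 6 → 6 ≤ N := by
      intro h5 h6
      by_contra hN6
      have hN5 : (N : ℤ) ≤ 5 := by
        have : N ≤ 5 := by omega
        exact_mod_cast this
      have hT1 : ∑ p ∈ P, ((if cls u v p = 1 then (1 : ℤ) else 0)
        - (cls u v p : ℤ) * (2 - cls u v p)) ≤ 5 := by
        rw [hT0, h5, h6]; push_cast; linarith
      have hle3 : ∀ p ∈ P, cls u v p ≤ 3 := by
        intro p hp
        by_contra hc
        have h1 := (Finset.single_le_sum hT hp).trans hT1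
        have h4 : (4 : ℤ) ≤ cls u v p := by
          have : 4 ≤ cls u v p := by omega
          exact_mod_cast this
        rw [if_neg (by omega)] at h1
        nlinarith
      have huniq : ∀ p ∈ P, ∀ q ∈ P, p ≠ q → cls u v p = 3 → cls u v q ≤ 2 := by
        intro p hp q hq hpq hp3
        by_contra hc
        have hq3 : cls u v q = 3 := by have := hle3 q hq; omega
        have hsub : ({p, q} : Finset (ℂ × ℂ)) ⊆ P := by
          intro x hx
          simp only [Finset.mem_insert, Finset.mem_singleton] at hx
          rcases hx with rfl | rfl <;> assumption
        have h1 := (Finset.sum_le_sum_of_subset_of_nonneg hsub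
          (fun x hx _ => hT x hx)).trans hT1
        rw [Finset.sum_pair hpq, hp3, hq3] at h1
        norm_num at h1
      by_cases h3 : ∃ p ∈ P, cls u v p = 3
      · obtain ⟨⟨a, w⟩, hp, hp3⟩ := h3
        have haS : a ∈ S := ((mem_pts u v S).mp hp).1
        have htwo : ∀ i, u i * a + v i ≠ w → cls u v (a, u i * a + v i) = 2 := by
          intro i hi
          have hle : ∀ b ∈ S, cls u v (b, u i * b + v i) ≤ 2 := by
            intro b hb
            refine huniq (a, w) hp _ ((mem_pts u v S).mpr ⟨hb, i, rfl⟩) ?_ hp3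
            intro h
            obtain ⟨rfl, h'⟩ := Prod.ext_iff.mp h
            exact hi h'.symm
          have hsum := sum_line u v S hu hag i
          rw [← Finset.add_sum_erase S _ haS] at hsum
          have hrest : ∑ b ∈ S.erase a, cls u v (b, u i * b + v i) ≤ ∑ b ∈ S.erase a, 2 :=
            Finset.sum_le_sum fun b hb => hle b (Finset.mem_of_mem_erase hb)
          rw [Finset.sum_const, Finset.card_erase_of_mem haS, smul_eq_mul] at hrest
          have := hle a haS
          omega
        have hcount := Finset.card_eq_sum_card_image (fun i => u i * a + v i)
          (Finset.univ : Finset ι)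
        obtain ⟨i0, hi0⟩ := ((mem_pts u v S).mp hp).2
        have hwmem : w ∈ Finset.univ.image (fun i => u i * a + v i) :=
          Finset.mem_image.mpr ⟨i0, Finset.mem_univ _, hi0⟩
        rw [← Finset.add_sum_erase _ _ hwmem] at hcount
        have hrest : ∑ w' ∈ (Finset.univ.image (fun i => u i * a + v i)).erase w,
            (Finset.univ.filter (fun i => u i * a + v i = w')).card
            = ∑ w' ∈ (Finset.univ.image (fun i => u i * a + v i)).erase w, 2 := by
          refine Finset.sum_congr rfl fun w' hw' => ?_
          obtain ⟨i, _, hi⟩ := Finset.mem_image.mp (Finset.mem_of_mem_erase hw')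
          have := htwo i (by rw [hi]; exact Finset.ne_of_mem_erase hw')
          rw [hi] at this
          exact this
        rw [hrest, Finset.sum_const, smul_eq_mul, Finset.card_univ] at hcount
        have h3' : (Finset.univ.filter (fun i => u i * a + v i = w)).card = 3 := hp3
        omega
      · push Not at h3
        refine no_factorization u v S hu hag (by omega) (by omega) fun p hp => ?_
        have := hle3 p hp
        have := h3 p hp
        omega
    clear_value n m N
    have hm : m = 3 ∨ m = 4 ∨ m = 5 := by omega
    rcases hm with rfl | rfl | rfl
    · interval_cases n <;> norm_num at hB <;> omega
    · have : n ≤ 5 := by omega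
      interval_cases n <;> norm_num at hB hC <;> omega
    · have : n ≤ 7 := by omega
      interval_cases n <;> norm_num at hB hC hE <;> omega

end SSComb

section SSGeom

lemma onLine_mk (w : Fin 3 → ℂ) (hw : w ≠ 0) (L : ProjLine) :
    PointOnLine (Projectivization.mk ℂ w hw) L ↔ L.rep w = 0 := by
  obtain ⟨c, hc⟩ := Projectivization.exists_smul_eq_mk_rep ℂ w hw
  unfold PointOnLine
  rw [← hc, Units.smul_def, map_smul, smul_eq_zero]
  simp

lemma proj_eq_of_smul {V : Type*} [AddCommGroup V] [Module ℂ V] (L L' : ℙ ℂ V) (c : ℂ)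
    (h : c • L'.rep = L.rep) : L = L' := by
  rw [← L.mk_rep, ← L'.mk_rep, Projectivization.mk_eq_mk_iff']
  exact ⟨c, h⟩

lemma exists_frame (P0 : Fin 3 → ℂ) (hP0 : P0 ≠ 0) (V : Finset ProjLine) (hV : V.Nonempty)
    (hVP : ∀ L ∈ V, L.rep P0 = 0) :
    ∃ e1 e2 : Fin 3 → ℂ, (∀ L ∈ V, L.rep e2 ≠ 0) ∧
      (∀ w, ∃ x y z : ℂ, w = x • e1 + y • e2 + z • P0) ∧
      (∀ x y z : ℂ, x • e1 + y • e2 + z • P0 = 0 → x = 0 ∧ y = 0 ∧ z = 0) := by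
  obtain ⟨e2, he2⟩ := Module.Dual.exists_forall_ne_zero_of_forall_exists
    (fun L : V => L.1.rep) (fun L => by
      by_contra hc
      push Not at hc
      exact L.1.rep_nonzero (LinearMap.ext hc))
  obtain ⟨L, hL⟩ := hV
  have hli : LinearIndependent ℂ ![e2, P0] := by
    rw [LinearIndependent.pair_iff]
    intro s t hst
    have h1 := congrArg L.rep hst
    simp only [map_add, map_smul, hVP L hL, smul_eq_mul, mul_zero, add_zero, map_zero] at h1
    have hs : s = 0 := (mul_eq_zero.mp h1).resolve_right (he2 ⟨L, hL⟩)
    subst hs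
    simp only [zero_smul, zero_add] at hst
    exact ⟨rfl, (smul_eq_zero.mp hst).resolve_right hP0⟩
  obtain ⟨e1, he1⟩ : ∃ e1, e1 ∉ Submodule.span ℂ (Set.range ![e2, P0]) := by
    by_contra hc
    push Not at hc
    have htop : Submodule.span ℂ (Set.range ![e2, P0]) = ⊤ := by
      rw [Submodule.eq_top_iff']; exact hc
    have := finrank_span_eq_card hli
    rw [htop, finrank_top] at this
    simp at this
  have hli3 : LinearIndependent ℂ ![e1, e2, P0] :=
    linearIndependent_finCons.mpr ⟨hli, he1⟩
  refine ⟨e1, e2, fun L hL => he2 ⟨L, hL⟩, ?_, ?_⟩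
  · intro w
    have hsp := hli3.span_eq_top_of_card_eq_finrank (by simp)
    have hw : w ∈ Submodule.span ℂ (Set.range ![e1, e2, P0]) := by rw [hsp]; trivial
    rw [Submodule.mem_span_range_iff_exists_fun] at hw
    obtain ⟨c, hc⟩ := hw
    refine ⟨c 0, c 1, c 2, ?_⟩
    rw [← hc, Fin.sum_univ_three]
    rfl
  · intro x y z h
    have := Fintype.linearIndependent_iff.mp hli3 ![x, y, z] (by
      rw [Fin.sum_univ_three]; exact h)
    exact ⟨this 0, this 1, this 2⟩

lemma exists_common (l l' : Module.Dual ℂ (Fin 3 → ℂ)) :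
    ∃ q : Fin 3 → ℂ, q ≠ 0 ∧ l q = 0 ∧ l' q = 0 := by
  have h := LinearMap.ker_ne_bot_of_finrank_lt (f := l.prod l') (by simp)
  obtain ⟨q, hq, hq0⟩ := (Submodule.ne_bot_iff _).mp h
  rw [LinearMap.mem_ker, LinearMap.prod_apply] at hq
  exact ⟨q, hq0, (Prod.ext_iff.mp hq).1, (Prod.ext_iff.mp hq).2⟩

lemma mult_eq (A : Finset ProjLine) (p : ProjPoint) :
    mult A p = (A.filter (fun L => PointOnLine p L)).card := by
  unfold mult
  rw [← Set.ncard_coe_finset]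
  congr 1
  ext L
  simp

lemma two_le_mult (A : Finset ProjLine) (p : ProjPoint) {L L' : ProjLine} (hL : L ∈ A)
    (hL' : L' ∈ A) (hne : L ≠ L') (h : PointOnLine p L) (h' : PointOnLine p L') :
    2 ≤ mult A p := by
  rw [mult_eq]
  exact Finset.one_lt_card.mpr ⟨L, by simp [hL, h], L', by simp [hL', h'], hne⟩

lemma geom_main (A : Finset ProjLine) (p : ProjPoint) (hp : IsModular A p)
    (hm3 : 3 ≤ mult A p) (hm5 : mult A p ≤ 5) (hpencil : ¬ IsPencil A) :
    A.card ≤ 2 * nk A 2 := by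
  obtain ⟨_, hmod⟩ := hp
  set V := A.filter (fun L => PointOnLine p L) with hV
  set N := A.filter (fun L => ¬ PointOnLine p L) with hN
  have hVc : mult A p = V.card := mult_eq A p
  have hAc : V.card + N.card = A.card := Finset.card_filter_add_card_filter_not _
  set P0 := p.rep with hP0
  have hVP : ∀ L ∈ V, L.rep P0 = 0 := fun L hL => (Finset.mem_filter.mp hL).2
  have hNP : ∀ L ∈ N, L.rep P0 ≠ 0 := fun L hL => (Finset.mem_filter.mp hL).2
  obtain ⟨e1, e2, he2, hspan, hind⟩ := exists_frame P0 p.rep_nonzero V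
    (Finset.card_pos.mp (by omega)) hVP
  -- uniqueness of lines
  have hlin : ∀ (L : ProjLine) (x y z : ℂ), L.rep (x • e1 + y • e2 + z • P0)
      = x * L.rep e1 + y * L.rep e2 + z * L.rep P0 := by
    intro L x y z
    simp only [map_add, map_smul, smul_eq_mul]
  have hLeq : ∀ (L L' : ProjLine) (c : ℂ), L.rep e1 = c * L'.rep e1 → L.rep e2 = c * L'.rep e2 →
      L.rep P0 = c * L'.rep P0 → L = L' := by
    intro L L' c h1 h2 h3
    refine proj_eq_of_smul L L' c (LinearMap.ext fun w => ?_)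
    obtain ⟨x, y, z, rfl⟩ := hspan w
    rw [LinearMap.smul_apply, hlin, hlin, smul_eq_mul, h1, h2, h3]
    ring
  -- slopes of the lines through p
  set s : ProjLine → ℂ := fun L => -L.rep e1 / L.rep e2 with hs
  have hsV : ∀ L ∈ V, ∀ a : ℂ, L.rep e1 + a * L.rep e2 = 0 ↔ a = s L := by
    intro L hL a
    have := he2 L hL
    simp only [hs]
    rw [eq_div_iff this]
    constructor
    · intro h; linear_combination h
    · intro h; linear_combination h
  have hsinj : Set.InjOn s V := by
    intro L hL L' hL' h
    have h1 := (hsV L hL (s L)).mpr rfl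
    have h2 := (hsV L' hL' (s L)).mpr h
    have n1 := he2 L hL
    have n2 := he2 L' hL'
    refine hLeq L L' (L.rep e2 / L'.rep e2) ?_ ?_ ?_
    · rw [eq_neg_of_add_eq_zero_left h1, eq_neg_of_add_eq_zero_left h2]
      field_simp
    · field_simp
    · rw [hVP L hL, hVP L' hL', mul_zero]
  set S := V.image s with hSdef
  have hSc : S.card = mult A p := by rw [hVc, hSdef, Finset.card_image_of_injOn hsinj]
  -- affine equations of the other lines
  set u : N → ℂ := fun L => -L.1.rep e2 / L.1.rep P0 with hu
  set v : N → ℂ := fun L => -L.1.rep e1 / L.1.rep P0 with hv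
  have huv : ∀ (L : N) (a y : ℂ), L.1.rep e1 + a * L.1.rep e2 + y * L.1.rep P0 = 0 ↔
      u L * a + v L = y := by
    intro L a y
    have := hNP L.1 L.2
    simp only [hu, hv]
    have e : -L.1.rep e2 / L.1.rep P0 * a + -L.1.rep e1 / L.1.rep P0
      = -(L.1.rep e1 + a * L.1.rep e2) / L.1.rep P0 := by ring
    rw [e, div_eq_iff this]
    constructor
    · intro h; linear_combination -h
    · intro h; linear_combination -h
  -- a point different from p lying on a line of V has a normal form
  have hnorm : ∀ q : Fin 3 → ℂ, q ≠ 0 → (∀ z : ℂ, q ≠ z • P0) → ∀ M ∈ V, M.rep q = 0 →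
      ∃ x y : ℂ, x ≠ 0 ∧ q = x • ((1 : ℂ) • e1 + (s M) • e2 + y • P0) := by
    intro q hq hqP M hM hMq
    obtain ⟨x, y, z, rfl⟩ := hspan q
    rw [hlin, hVP M hM, mul_zero, add_zero] at hMq
    have hx : x ≠ 0 := by
      rintro rfl
      rw [zero_mul, zero_add] at hMq
      have hy := (mul_eq_zero.mp hMq).resolve_right (he2 M hM)
      subst hy
      exact hqP z (by simp)
    refine ⟨x, z / x, hx, ?_⟩
    have hsm : y / x = s M := (hsV M hM (y / x)).mp (by field_simp; linear_combination hMq)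
    rw [← hsm, smul_add, smul_add, smul_smul, smul_smul, smul_smul, mul_one,
      mul_div_cancel₀ _ hx, mul_div_cancel₀ _ hx]
  have hag : ∀ i j : N, i ≠ j → ∃ a ∈ S, u i * a + v i = u j * a + v j := by
    intro i j hij
    obtain ⟨q, hq0, hqi, hqj⟩ := exists_common i.1.rep j.1.rep
    have hiA : i.1 ∈ A := (Finset.mem_filter.mp i.2).1
    have hjA : j.1 ∈ A := (Finset.mem_filter.mp j.2).1
    have hqP : ∀ z : ℂ, q ≠ z • P0 := by
      rintro z rfl
      rw [map_smul, smul_eq_mul] at hqi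
      have hz := (mul_eq_zero.mp hqi).resolve_right (hNP i.1 i.2)
      exact hq0 (by rw [hz, zero_smul])
    have hIP : IsIntersectionPoint A (Projectivization.mk ℂ q hq0) :=
      two_le_mult A _ hiA hjA (fun h => hij (Subtype.ext h))
        ((onLine_mk q hq0 _).mpr hqi) ((onLine_mk q hq0 _).mpr hqj)
    have hneq : Projectivization.mk ℂ q hq0 ≠ p := by
      intro h
      rw [← p.mk_rep, Projectivization.mk_eq_mk_iff'] at h
      obtain ⟨z, hz⟩ := h
      exact hqP z hz.symm
    obtain ⟨M, hMA, hMp, hMq⟩ := hmod _ hIP hneq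
    have hM : M ∈ V := Finset.mem_filter.mpr ⟨hMA, hMp⟩
    obtain ⟨x, y, hx, hq⟩ := hnorm q hq0 hqP M hM ((onLine_mk q hq0 M).mp hMq)
    refine ⟨s M, Finset.mem_image_of_mem _ hM, ?_⟩
    have key : ∀ L : N, L.1.rep q = 0 → u L * s M + v L = y := by
      intro L hL
      rw [hq, map_smul, smul_eq_mul, hlin] at hL
      have := (mul_eq_zero.mp hL).resolve_left hx
      exact (huv L (s M) y).mp (by linear_combination this)
    rw [key i hqi, key j hqj]
  have huinj : Function.Injective u := by
    intro i j hij
    by_contra hne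
    obtain ⟨a, _, ha⟩ := hag i j hne
    rw [hij] at ha
    have hvij : v i = v j := add_left_cancel ha
    have n1 := hNP i.1 i.2
    have n2 := hNP j.1 j.2
    simp only [hu] at hij
    simp only [hv] at hvij
    rw [div_eq_div_iff n1 n2] at hij hvij
    apply hne
    apply Subtype.ext
    refine hLeq i.1 j.1 (i.1.rep P0 / j.1.rep P0) ?_ ?_ ?_
    · field_simp; linear_combination -hvij
    · field_simp; linear_combination -hij
    · field_simp
  have hNpos : 1 ≤ Fintype.card N := by
    rw [Fintype.card_coe]
    by_contra hc
    have h0 : N = ∅ := Finset.card_eq_zero.mp (by omega)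
    apply hpencil
    refine ⟨p, fun L hL => ?_⟩
    by_contra hLp
    have : L ∈ N := Finset.mem_filter.mpr ⟨hL, hLp⟩
    rw [h0] at this
    simp at this
  have hcomb := comb_main u v S huinj hag (by omega) (by omega) hNpos
  rw [Fintype.card_coe] at hcomb
  -- the points
  have hvec0 : ∀ a y : ℂ, (1 : ℂ) • e1 + a • e2 + y • P0 ≠ 0 := by
    intro a y h
    exact one_ne_zero (hind 1 a y h).1
  set pt : ℂ × ℂ → ProjPoint := fun x =>
    Projectivization.mk ℂ ((1 : ℂ) • e1 + x.1 • e2 + x.2 • P0) (hvec0 x.1 x.2) with hpt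
  have hptinj : Function.Injective pt := by
    rintro ⟨a, y⟩ ⟨a', y'⟩ h
    simp only [hpt] at h
    rw [Projectivization.mk_eq_mk_iff'] at h
    obtain ⟨c, hc⟩ := h
    have h0 : (c - 1) • e1 + (c * a' - a) • e2 + (c * y' - y) • P0 = 0 := by
      rw [← sub_eq_zero] at hc
      rw [← hc]
      module
    obtain ⟨h1, h2, h3⟩ := hind _ _ _ h0
    have hc1 : c = 1 := sub_eq_zero.mp h1
    subst hc1
    rw [one_mul, sub_eq_zero] at h2 h3
    rw [h2, h3]
  have hptV : ∀ L ∈ V, ∀ x : ℂ × ℂ, PointOnLine (pt x) L ↔ x.1 = s L := by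
    intro L hL x
    simp only [hpt]
    rw [onLine_mk, hlin, hVP L hL, mul_zero, add_zero, one_mul]
    exact hsV L hL x.1
  have hptN : ∀ (L : N) (x : ℂ × ℂ), PointOnLine (pt x) L.1 ↔ u L * x.1 + v L = x.2 := by
    intro L x
    simp only [hpt]
    rw [onLine_mk, hlin, one_mul]
    exact huv L x.1 x.2
  have hmem : ∀ L ∈ A, L ∈ V ∨ L ∈ N := by
    intro L hL
    by_cases h : PointOnLine p L
    · exact Or.inl (Finset.mem_filter.mpr ⟨hL, h⟩)
    · exact Or.inr (Finset.mem_filter.mpr ⟨hL, h⟩)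
  have hVN : ∀ L ∈ V, L ∉ N := by
    intro L hL hL'
    exact (Finset.mem_filter.mp hL').2 (Finset.mem_filter.mp hL).2
  have hdouble : ∀ x ∈ (pts u v S).filter (fun x => cls u v x = 1), mult A (pt x) = 2 := by
    intro x hx
    obtain ⟨hx1, hx2⟩ := Finset.mem_filter.mp hx
    obtain ⟨M, hM, hMs⟩ := Finset.mem_image.mp ((mem_pts u v S).mp hx1).1
    obtain ⟨i, hi⟩ := Finset.card_eq_one.mp hx2
    have hi' : ∀ j, u j * x.1 + v j = x.2 ↔ j = i := by
      intro j
      have := Finset.ext_iff.mp hi j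
      simpa using this
    rw [mult_eq, Finset.card_eq_two]
    refine ⟨M, i.1, fun h => hVN M hM (h ▸ i.2), ?_⟩
    ext L
    simp only [Finset.mem_filter, Finset.mem_insert, Finset.mem_singleton]
    constructor
    · rintro ⟨hLA, hLx⟩
      rcases hmem L hLA with hL | hL
      · left
        have := (hptV L hL x).mp hLx
        exact hsinj hL hM (by rw [← this, hMs])
      · right
        have := (hptN ⟨L, hL⟩ x).mp hLx
        exact congrArg Subtype.val ((hi' _).mp this)
    · rintro (rfl | rfl)
      · exact ⟨(Finset.mem_filter.mp hM).1, (hptV _ hM x).mpr hMs.symm⟩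
      · exact ⟨(Finset.mem_filter.mp i.2).1, (hptN i x).mpr ((hi' i).mpr rfl)⟩
  have hfin : {q : ProjPoint | IsIntersectionPoint A q ∧ mult A q = 2}.Finite := by
    refine Set.Finite.subset ((pts u v S).image pt).finite_toSet ?_
    rintro q ⟨hqi, hq2⟩
    have hqp : q ≠ p := by
      rintro rfl
      omega
    obtain ⟨M, hMA, hMp, hMq⟩ := hmod q hqi hqp
    have hM : M ∈ V := Finset.mem_filter.mpr ⟨hMA, hMp⟩
    obtain ⟨x, y, hx, hq⟩ := hnorm q.rep q.rep_nonzero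
      (fun z hz => hqp (proj_eq_of_smul q p z hz.symm)) M hM hMq
    have hqpt : q = pt (s M, y) := by
      rw [← q.mk_rep]
      simp only [hpt]
      rw [Projectivization.mk_eq_mk_iff']
      exact ⟨x, hq.symm⟩
    rw [mult_eq] at hq2
    have hMf : M ∈ A.filter (fun L => PointOnLine q L) := Finset.mem_filter.mpr ⟨hMA, hMq⟩
    have h1c : 1 < (A.filter (fun L => PointOnLine q L)).card := by omega
    obtain ⟨L, hL, hLM⟩ := Finset.exists_mem_ne h1c M
    obtain ⟨hLA, hLq⟩ := Finset.mem_filter.mp hL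
    rw [hqpt] at hLq
    rw [Finset.mem_coe, hqpt]
    refine Finset.mem_image_of_mem _ ((mem_pts u v S).mpr ⟨Finset.mem_image_of_mem _ hM, ?_⟩)
    rcases hmem L hLA with hLV | hLN
    · exact absurd (hsinj hLV hM ((hptV L hLV _).mp hLq).symm) hLM
    · exact ⟨⟨L, hLN⟩, (hptN ⟨L, hLN⟩ _).mp hLq⟩
  have hle : ((pts u v S).filter (fun x => cls u v x = 1)).card ≤ nk A 2 := by
    rw [← Finset.card_image_of_injective _ hptinj, ← Set.ncard_coe_finset]
    refine Set.ncard_le_ncard ?_ hfin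
    intro q hq
    obtain ⟨x, hx, rfl⟩ := Finset.mem_image.mp (Finset.mem_coe.mp hq)
    have := hdouble x hx
    exact ⟨by unfold IsIntersectionPoint; omega, this⟩
  omega

end SSGeom

/-- An `m`-homogeneous supersolvable line arrangement with
`3 ≤ m ≤ 5`, not a pencil, with `d` lines, satisfies `n₂ ≥ d/2`. -/
theorem n2_ge_half_of_m_le_five (A : Finset ProjLine) (m : ℕ)
    (hm3 : 3 ≤ m) (hm5 : m ≤ 5) (h : IsHomogSS A m) (hpencil : ¬ IsPencil A) :
    (A.card : ℝ) / 2 ≤ (nk A 2 : ℝ) := by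
  obtain ⟨⟨p, hp⟩, hall⟩ := h
  have hpm := hall p hp
  have h1 := geom_main A p hp (by omega) (by omega) hpencil
  have h2 : (A.card : ℝ) ≤ 2 * (nk A 2 : ℝ) := by exact_mod_cast h1
  linarith

end
end

section
/- Let A' be a generic arrangement of d' ≥ 3 lines in ℙ² and let p ∈ ℙ² be any point not lying on a line of A'. Then the number N' of distinct lines joining p to the intersection points (nodes) of A' satisfies N' ≥ d'. -/
open scoped LinearAlgebra.Projectivization

noncomputable section

attribute [local instance] Classical.propDecidable

/-- A generic line arrangement: all intersection points are double points. -/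
def IsGeneric (A : Finset ProjLine) : Prop :=
  ∀ p, IsIntersectionPoint A p → mult A p = 2

/-- `A` is the cone `C(A',p)_e` over `A'` with vertex `p`: the point `p` lies on no
line of `A'`, and `A` consists of the lines of `A'`, all the lines joining `p` to the
intersection points of `A'`, and `e` further distinct lines through `p`, each meeting
the lines of `A'` only in points lying on exactly one line of `A'`. -/
def IsConeOf (A' : Finset ProjLine) (p : ProjPoint) (e : ℕ) (A : Finset ProjLine) : Prop :=
  (∀ L ∈ A', ¬ PointOnLine p L) ∧
  ∃ E : Finset ProjLine, E.card = e ∧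
    (∀ L ∈ E, PointOnLine p L ∧ ∀ q : ProjPoint, PointOnLine q L → mult A' q ≤ 1) ∧
    ∀ L : ProjLine, L ∈ A ↔ (L ∈ A' ∨ L ∈ E ∨
      (PointOnLine p L ∧ ∃ q : ProjPoint, IsIntersectionPoint A' q ∧ PointOnLine q L))


open Polynomial in
/-- Coefficients of the formal square root of a series with coefficients `h`. -/
noncomputable def sqrtCoeff (h : ℕ → ℂ[X]) : ℕ → ℂ[X]
  | 0 => 1
  | (n+1) => C (1/2) * (h (n+1) - ∑ i : Fin n, sqrtCoeff h (i.1+1) * sqrtCoeff h (n - i.1))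
termination_by n => n
decreasing_by all_goals omega

open Polynomial in
lemma sqrtCoeff_natDegree (h : ℕ → ℂ[X]) (hh : ∀ n, (h n).natDegree ≤ n) (n : ℕ) :
    (sqrtCoeff h n).natDegree ≤ n := by
  induction n using Nat.strong_induction_on with
  | _ n ih =>
    cases n with
    | zero => simp [sqrtCoeff]
    | succ n =>
      rw [sqrtCoeff]
      refine (natDegree_C_mul_le _ _).trans ?_
      refine (natDegree_sub_le _ _).trans (max_le (hh _) ?_)
      refine natDegree_sum_le_of_forall_le _ _ ?_
      intro i _
      refine natDegree_mul_le.trans ?_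
      have h1 := ih (i.1+1) (by omega)
      have h2 := ih (n - i.1) (by omega)
      omega

open Polynomial in
lemma sqrtCoeff_eval (h : ℕ → ℂ[X]) (m : ℂ) (S : ℂ[X]) (h0 : S.coeff 0 = 1)
    (hS : ∀ n, (S ^ 2).coeff n = (h n).eval m) (n : ℕ) :
    (sqrtCoeff h n).eval m = S.coeff n := by
  induction n using Nat.strong_induction_on with
  | _ n ih =>
    cases n with
    | zero => simp [sqrtCoeff, h0]
    | succ n =>
      rw [sqrtCoeff]
      simp only [eval_mul, eval_C, eval_sub, eval_finsetSum]
      have h1 : ∀ i : Fin n, eval m (sqrtCoeff h (i.1+1)) * eval m (sqrtCoeff h (n - i.1))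
          = S.coeff (i.1+1) * S.coeff (n - i.1) := by
        intro i
        rw [ih _ (by omega), ih _ (by omega)]
      rw [Finset.sum_congr rfl (fun i _ => h1 i)]
      rw [← hS, pow_two, coeff_mul, Finset.Nat.sum_antidiagonal_eq_sum_range_succ_mk,
        Finset.sum_range_succ', Finset.sum_range_succ,
        Fin.sum_univ_eq_sum_range (fun i => S.coeff (i+1) * S.coeff (n - i)) n]
      simp only [Nat.add_sub_add_right, Nat.sub_self, h0, Nat.sub_zero]
      ring

open Polynomial in
lemma telescoping (Q : ℂ[X]) (v : ℂ) (n : ℕ) :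
    ∑ j ∈ Finset.range (n+1), ((1 - C v * X) * Q).coeff j * v ^ (n - j) = Q.coeff n := by
  induction n with
  | zero => simp [sub_mul, mul_assoc]
  | succ n ih =>
    rw [Finset.sum_range_succ]
    have : ∑ j ∈ Finset.range (n+1), ((1 - C v * X) * Q).coeff j * v ^ (n + 1 - j) =
        v * Q.coeff n := by
      rw [← ih, Finset.mul_sum]
      refine Finset.sum_congr rfl fun j hj => ?_
      have : n + 1 - j = (n - j) + 1 := by
        have := Finset.mem_range.1 hj
        omega
      rw [this]; ring
    rw [this]
    simp [sub_mul, mul_assoc, coeff_X_mul]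

open Polynomial in
lemma coeff_bound {ι : Type*} (s : Finset ι) (y : ι → ℂ[X]) (hy : ∀ i, (y i).natDegree ≤ 1)
    (n : ℕ) : ((∏ i ∈ s, (1 - C (y i) * X)).coeff n).natDegree ≤ n := by
  classical
  induction s using Finset.induction_on generalizing n with
  | empty => simp [coeff_one]; split_ifs <;> simp
  | insert a s ha ih =>
    rw [Finset.prod_insert ha, sub_mul, one_mul, mul_assoc, coeff_sub, coeff_C_mul]
    refine (natDegree_sub_le _ _).trans (max_le (ih n) ?_)
    cases n with
    | zero => simp
    | succ n =>
      rw [coeff_X_mul]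
      refine natDegree_mul_le.trans ?_
      have := ih n
      have := hy a
      omega

open Polynomial in
theorem core {ι : Type*} [Fintype ι] [DecidableEq ι] (hd : 3 ≤ Fintype.card ι)
    (a b : ι → ℂ) (ha : Function.Injective a) (M : Finset ℂ)
    (hM : ∀ i j, i ≠ j → ∃ m ∈ M, b i + m * a i = b j + m * a j)
    (hg : ∀ m i j k, i ≠ j → i ≠ k → j ≠ k → b i + m * a i = b j + m * a j →
      b i + m * a i = b k + m * a k → False) :
    Fintype.card ι ≤ M.card := by
  by_contra hlt
  push Not at hlt
  choose! μ hμM hμ using hM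
  have hinj : ∀ i, Set.InjOn (μ i) (Finset.univ.erase i : Finset ι) := by
    intro i j hj k hk hjk
    simp only [Finset.coe_erase, Finset.coe_univ, Set.mem_sdiff, Set.mem_univ, true_and,
      Set.mem_singleton_iff] at hj hk
    by_contra hne
    refine hg (μ i j) i j k (Ne.symm hj) (Ne.symm hk) hne (hμ i j (Ne.symm hj)) ?_
    rw [hjk]; exact hμ i k (Ne.symm hk)
  have himg : ∀ i, (Finset.univ.erase i).image (μ i) ⊆ M := by
    intro i m hm
    obtain ⟨j, hj, rfl⟩ := Finset.mem_image.1 hm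
    exact hμM i j (Finset.ne_of_mem_erase hj).symm
  have hcard : ∀ i, ((Finset.univ.erase i).image (μ i)).card = Fintype.card ι - 1 := by
    intro i
    rw [Finset.card_image_of_injOn (hinj i), Finset.card_erase_of_mem (Finset.mem_univ _),
      Finset.card_univ]
  have hsurj : ∀ i, ∀ m ∈ M, ∃ j, j ≠ i ∧ b i + m * a i = b j + m * a j := by
    intro i m hm
    have : (Finset.univ.erase i).image (μ i) = M :=
      Finset.eq_of_subset_of_card_le (himg i) (by rw [hcard]; omega)
    rw [← this] at hm
    obtain ⟨j, hj, rfl⟩ := Finset.mem_image.1 hm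
    have := Finset.ne_of_mem_erase hj
    exact ⟨j, this, hμ i j this.symm⟩
  obtain ⟨i0⟩ : Nonempty ι := Fintype.card_pos_iff.1 (by omega)
  have hMc : M.card = Fintype.card ι - 1 := by
    have := Finset.card_le_card (himg i0)
    rw [hcard] at this
    omega
  -- every fibre has two elements
  have hfib : ∀ m ∈ M, ∀ v ∈ Finset.univ.image (fun i => b i + m * a i),
      (Finset.univ.filter (fun i => b i + m * a i = v)).card = 2 := by
    intro m hm v hv
    obtain ⟨i, -, rfl⟩ := Finset.mem_image.1 hv
    obtain ⟨j, hji, hj⟩ := hsurj i m hm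
    rw [Finset.card_eq_two]
    refine ⟨i, j, hji.symm, ?_⟩
    ext k
    simp only [Finset.mem_filter, Finset.mem_univ, true_and, Finset.mem_insert,
      Finset.mem_singleton]
    constructor
    · intro hk
      by_contra hne
      push Not at hne
      exact hg m i j k hji.symm (Ne.symm hne.1) (Ne.symm hne.2) hj hk.symm
    · rintro (rfl | rfl)
      · rfl
      · exact hj.symm
  have hV : ∀ m ∈ M, Fintype.card ι = 2 * (Finset.univ.image (fun i => b i + m * a i)).card := by
    intro m hm
    rw [← Finset.card_univ, Finset.card_eq_sum_card_image (fun i => b i + m * a i) Finset.univ,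
      Finset.sum_congr rfl (hfib m hm)]
    simp [mul_comm]
  obtain ⟨e, he⟩ : ∃ e, Fintype.card ι = 2 * e := by
    obtain ⟨m, hm⟩ : M.Nonempty := Finset.card_pos.1 (by omega)
    exact ⟨_, hV m hm⟩
  let y : ι → ℂ[X] := fun i => C (b i) + X * C (a i)
  have hy : ∀ i, (y i).natDegree ≤ 1 := by
    intro i
    simp only [y]
    compute_degree
  let h : ℕ → ℂ[X] := fun n => (∏ i, (1 - C (y i) * X)).coeff n
  have hh : ∀ n, (h n).natDegree ≤ n := fun n => coeff_bound _ y hy n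
  let g := sqrtCoeff h
  have hgd : ∀ n, (g n).natDegree ≤ n := sqrtCoeff_natDegree h hh
  have hgm : ∀ m ∈ M, ∀ n, (g n).eval m =
      (∏ v ∈ Finset.univ.image (fun i => b i + m * a i), (1 - C v * X)).coeff n := by
    intro m hm
    refine sqrtCoeff_eval h m _ ?_ ?_
    · simp [coeff_zero_prod]
    · intro n
      have h1 : (h n).eval m = ((∏ i, (1 - C (y i) * X)).map (evalRingHom m)).coeff n := by
        rw [coeff_map]; rfl
      rw [h1, Polynomial.map_prod]
      congr 1
      have h2 : ∀ i, Polynomial.map (evalRingHom m) (1 - C (y i) * X)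
          = (fun v => 1 - C v * X) (b i + m * a i) := by
        intro i; simp [y]; ring
      rw [Finset.prod_congr rfl (fun i _ => h2 i),
        Finset.prod_comp (fun v : ℂ => (1 - C v * X : ℂ[X])) (fun i => b i + m * a i),
        ← Finset.prod_pow]
      refine Finset.prod_congr rfl fun v hv => ?_
      rw [hfib m hm v hv]
  have hroot : ∀ m ∈ M, ∀ i,
      ∑ j ∈ Finset.range (e+1), (g j).eval m * (b i + m * a i) ^ (e - j) = 0 := by
    intro m hm i
    have hv : b i + m * a i ∈ Finset.univ.image (fun i => b i + m * a i) :=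
      Finset.mem_image_of_mem _ (Finset.mem_univ i)
    have hVe := hV m hm
    simp only [hgm m hm]
    rw [← Finset.mul_prod_erase _ _ hv, telescoping]
    apply coeff_eq_zero_of_natDegree_lt
    refine (natDegree_prod_le _ _).trans_lt ?_
    refine (Finset.sum_le_card_nsmul _ _ 1 ?_).trans_lt ?_
    · intro v _
      compute_degree
    · rw [Finset.card_erase_of_mem hv]
      simp only [smul_eq_mul, mul_one]
      omega
  have hzero : ∀ i, ∑ j ∈ Finset.range (e+1), g j * y i ^ (e - j) = 0 := by
    intro i
    refine Polynomial.eq_zero_of_natDegree_lt_card_of_eval_eq_zero' _ M ?_ ?_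
    · intro m hm
      rw [← hroot m hm i, eval_finsetSum]
      refine Finset.sum_congr rfl fun j _ => ?_
      simp only [y, eval_mul, eval_pow, eval_add, eval_C, eval_X]
    · refine lt_of_le_of_lt (b := e) ?_ (by omega)
      refine natDegree_sum_le_of_forall_le _ _ ?_
      intro j hj
      refine natDegree_mul_le.trans ?_
      have h1 := hgd j
      have h2 : (y i ^ (e - j)).natDegree ≤ (e - j) * 1 :=
        natDegree_pow_le.trans (Nat.mul_le_mul_left _ (hy i))
      have := Finset.mem_range.1 hj
      omega
  obtain ⟨m0, hm0⟩ := Infinite.exists_notMem_finset M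
  have hinj0 : Function.Injective (fun i => b i + m0 * a i) := by
    intro i j hij
    by_contra hne
    have h1 := hμ i j hne
    have h2 : (m0 - μ i j) * (a i - a j) = 0 := by
      simp only at hij
      linear_combination hij - h1
    rcases mul_eq_zero.1 h2 with h3 | h3
    · apply hm0
      rw [sub_eq_zero.1 h3]; exact hμM i j hne
    · exact hne (ha (sub_eq_zero.1 h3))
  let P : ℂ[X] := ∑ j ∈ Finset.range (e+1), C ((g j).eval m0) * X ^ (e - j)
  have hP : P = 0 := by
    refine Polynomial.eq_zero_of_natDegree_lt_card_of_eval_eq_zero P hinj0 ?_ ?_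
    · intro i
      have := congrArg (eval m0) (hzero i)
      rw [eval_finsetSum] at this
      simp only [P, eval_finsetSum]
      rw [eval_zero] at this
      rw [← this]
      refine Finset.sum_congr rfl fun j _ => ?_
      simp only [y, eval_mul, eval_pow, eval_add, eval_C, eval_X]
    · refine lt_of_le_of_lt (b := e) ?_ (by omega)
      refine natDegree_sum_le_of_forall_le _ _ ?_
      intro j _
      refine (natDegree_C_mul_X_pow_le _ _).trans (by omega)
  have hc : P.coeff e = 1 := by
    simp only [P, finsetSum_coeff, coeff_C_mul, coeff_X_pow]
    rw [Finset.sum_eq_single 0]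
    · simp [g, sqrtCoeff]
    · intro j hj hj0
      have := Finset.mem_range.1 hj
      rw [if_neg (by omega)]; simp
    · simp
  rw [hP] at hc
  simp at hc

lemma pointOnLine_mk_left (v : Fin 3 → ℂ) (hv : v ≠ 0) (L : ProjLine) :
    PointOnLine (Projectivization.mk ℂ v hv) L ↔ L.rep v = 0 := by
  obtain ⟨c, hc⟩ := Projectivization.exists_smul_eq_mk_rep ℂ v hv
  unfold PointOnLine
  rw [← hc, Units.smul_def, map_smul, smul_eq_mul]
  simp

lemma pointOnLine_mk_right (q : ProjPoint) (f : Module.Dual ℂ (Fin 3 → ℂ)) (hf : f ≠ 0) :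
    PointOnLine q (Projectivization.mk ℂ f hf) ↔ f q.rep = 0 := by
  obtain ⟨c, hc⟩ := Projectivization.exists_smul_eq_mk_rep ℂ f hf
  unfold PointOnLine
  rw [← hc, Units.smul_def, LinearMap.smul_apply, smul_eq_mul]
  simp

/-- Completing two independent vectors to a basis. -/
lemma exists_basis (u w : Fin 3 → ℂ) (h : LinearIndependent ℂ ![u, w]) :
    ∃ B : Module.Basis (Fin 3) ℂ (Fin 3 → ℂ), B 1 = u ∧ B 2 = w := by
  have hne : Submodule.span ℂ (Set.range ![u, w]) ≠ ⊤ := by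
    intro htop
    have h1 := finrank_span_eq_card h
    rw [htop, finrank_top] at h1
    simp at h1
  obtain ⟨x, -, hx⟩ := SetLike.exists_of_lt (lt_top_iff_ne_top.2 hne)
  have h3 : LinearIndependent ℂ (Fin.cons x ![u, w] : Fin 3 → Fin 3 → ℂ) :=
    linearIndependent_finCons.2 ⟨h, hx⟩
  refine ⟨basisOfLinearIndependentOfCardEqFinrank h3 (by simp), ?_, ?_⟩
  · rw [coe_basisOfLinearIndependentOfCardEqFinrank]; rfl
  · rw [coe_basisOfLinearIndependentOfCardEqFinrank]; rfl

/-- For a generic arrangement `A'` of `d' ≥ 3` lines and a point `p`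
on no line of `A'`, the number `N'` of distinct lines joining `p` to the nodes of `A'`
satisfies `N' ≥ d'`. -/
theorem joining_lines_ge (A' : Finset ProjLine) (hd' : 3 ≤ A'.card)
    (hgen : IsGeneric A') (p : ProjPoint)
    (hp : ∀ L ∈ A', ¬ PointOnLine p L) :
    (A'.card : ℕ) ≤
      {L : ProjLine | PointOnLine p L ∧
        ∃ q : ProjPoint, IsIntersectionPoint A' q ∧ PointOnLine q L}.ncard := by
  have hfin : ∀ q : ProjPoint, {L : ProjLine | L ∈ A' ∧ PointOnLine q L}.Finite :=
    fun q => A'.finite_toSet.subset fun L hL => hL.1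
  -- normalized linear forms
  let f : A' → Module.Dual ℂ (Fin 3 → ℂ) := fun L => (L.1.rep p.rep)⁻¹ • L.1.rep
  have hc : ∀ L : A', L.1.rep p.rep ≠ 0 := fun L => hp L.1 L.2
  have hfp : ∀ L, f L p.rep = 1 := by
    intro L
    simp only [f, LinearMap.smul_apply, smul_eq_mul]
    exact inv_mul_cancel₀ (hc L)
  have hf0 : ∀ L v, f L v = 0 ↔ L.1.rep v = 0 := by
    intro L v
    simp [f, hc L]
  have hfinj : ∀ L K, f L = f K → L = K := by
    intro L K h
    apply Subtype.ext
    rw [← Projectivization.mk_rep L.1, ← Projectivization.mk_rep K.1,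
      Projectivization.mk_eq_mk_iff']
    refine ⟨(L.1.rep p.rep) * (K.1.rep p.rep)⁻¹, ?_⟩
    rw [mul_smul]
    change (L.1.rep p.rep) • f K = _
    rw [← h]
    exact smul_inv_smul₀ (hc L) _
  obtain ⟨w1, hw1⟩ := Module.Dual.exists_forall_ne_zero_of_forall_exists
    (fun ij : {ij : A' × A' // ij.1 ≠ ij.2} => f ij.1.1 - f ij.1.2) (by
      intro ij
      by_contra hcon
      push Not at hcon
      exact ij.2 (hfinj _ _ (sub_eq_zero.1 (LinearMap.ext hcon))))
  have ha : Function.Injective (fun L => f L w1) := by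
    intro L K h
    by_contra hne
    refine hw1 ⟨(L, K), hne⟩ ?_
    simp only at h
    simp [h]
  obtain ⟨L0, L1, hL01⟩ : ∃ L0 L1 : A', L0 ≠ L1 := by
    have : Nontrivial A' := by
      rw [← Fintype.one_lt_card_iff_nontrivial, Fintype.card_coe]; omega
    exact exists_pair_ne _
  have hli : LinearIndependent ℂ ![p.rep, w1] := by
    rw [LinearIndependent.pair_iff' p.rep_nonzero]
    intro c h
    apply hL01
    apply ha
    simp only
    rw [← h, map_smul, map_smul, hfp, hfp]
  obtain ⟨B, hB1, hB2⟩ := exists_basis _ _ hli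
  obtain ⟨w0, hw0⟩ : ∃ w0, w0 = B 0 := ⟨_, rfl⟩
  have hexp : ∀ v, v = B.coord 0 v • w0 + B.coord 1 v • p.rep + B.coord 2 v • w1 := by
    intro v
    rw [hw0, ← hB1, ← hB2]
    conv_lhs => rw [← B.sum_repr v]
    rw [Fin.sum_univ_three]
    rfl
  have c0 : ∀ i, B.coord i w0 = if i = 0 then 1 else 0 := by
    intro i; rw [hw0]; simp [Finsupp.single_apply, eq_comm]
  have c1 : ∀ i, B.coord i p.rep = if i = 1 then 1 else 0 := by
    intro i; rw [← hB1]; simp [Finsupp.single_apply, eq_comm]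
  have c2 : ∀ i, B.coord i w1 = if i = 2 then 1 else 0 := by
    intro i; rw [← hB2]; simp [Finsupp.single_apply, eq_comm]
  -- the line through `p` with slope `m`
  let ψ : ℂ → Module.Dual ℂ (Fin 3 → ℂ) := fun m => B.coord 2 - m • B.coord 0
  have ψ0 : ∀ m, ψ m w0 = -m := by intro m; simp [ψ, c0, -Module.Basis.coord_apply]
  have ψ1 : ∀ m, ψ m p.rep = 0 := by intro m; simp [ψ, c1, -Module.Basis.coord_apply]
  have ψ2 : ∀ m, ψ m w1 = 1 := by intro m; simp [ψ, c2, -Module.Basis.coord_apply]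
  have ψne : ∀ m, ψ m ≠ 0 := by
    intro m h
    have := ψ2 m
    rw [h] at this
    simp at this
  let φ : ℂ → ProjLine := fun m => Projectivization.mk ℂ (ψ m) (ψne m)
  have φinj : Function.Injective φ := by
    intro m n h
    obtain ⟨c, hcc⟩ := (Projectivization.mk_eq_mk_iff' ..).1 h
    have h2 := congrArg (fun g => g w1) hcc
    have h0 := congrArg (fun g => g w0) hcc
    simp only [LinearMap.smul_apply, ψ0, ψ2, smul_eq_mul] at h0 h2
    have : c = 1 := by simpa using h2
    rw [this] at h0
    linear_combination h0
  -- the node on the line of slope `m` at height `t`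
  let nv : ℂ → ℂ → (Fin 3 → ℂ) := fun m t => w0 + m • w1 - t • p.rep
  have nvne : ∀ m t, nv m t ≠ 0 := by
    intro m t h
    have := congrArg (B.coord 0) h
    simp [nv, c0, c1, c2, -Module.Basis.coord_apply] at this
  have nvL : ∀ m t (L : A'), f L w0 + m * f L w1 = t →
      PointOnLine (Projectivization.mk ℂ (nv m t) (nvne m t)) L.1 := by
    intro m t L h
    rw [pointOnLine_mk_left, ← hf0]
    simp only [nv, map_sub, map_add, map_smul, smul_eq_mul, hfp]
    rw [h]; ring
  let μ : A' × A' → ℂ := fun x => -(f x.1 w0 - f x.2 w0) / (f x.1 w1 - f x.2 w1)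
  have hμ : ∀ i j, i ≠ j →
      f i w0 + μ (i, j) * f i w1 = f j w0 + μ (i, j) * f j w1 := by
    intro i j hij
    have : f i w1 - f j w1 ≠ 0 := fun h => hij (ha (sub_eq_zero.1 h))
    have h2 : μ (i, j) * (f i w1 - f j w1) = -(f i w0 - f j w0) := div_mul_cancel₀ _ this
    linear_combination h2
  let M : Finset ℂ := (Finset.univ.filter (fun x : A' × A' => x.1 ≠ x.2)).image μ
  have hcore : Fintype.card A' ≤ M.card := by
    refine core (by rw [Fintype.card_coe]; exact hd') (fun L => f L w1) (fun L => f L w0) ha M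
      ?_ ?_
    · intro i j hij
      exact ⟨μ (i, j), Finset.mem_image_of_mem _ (by simpa using hij), hμ i j hij⟩
    · intro m i j k hij hik hjk h1 h2
      let q := Projectivization.mk ℂ (nv m (f i w0 + m * f i w1)) (nvne m (f i w0 + m * f i w1))
      have hsub : (({i.1, j.1, k.1} : Finset ProjLine) : Set ProjLine) ⊆
          {L : ProjLine | L ∈ A' ∧ PointOnLine q L} := by
        intro L hL
        simp only [Finset.coe_insert, Finset.coe_singleton, Set.mem_insert_iff,
          Set.mem_singleton_iff] at hL
        rcases hL with rfl | rfl | rfl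
        · exact ⟨i.2, nvL _ _ i rfl⟩
        · exact ⟨j.2, nvL _ _ j h1.symm⟩
        · exact ⟨k.2, nvL _ _ k h2.symm⟩
      have h3 := Set.ncard_le_ncard hsub (hfin q)
      rw [Set.ncard_coe_finset, Finset.card_eq_three.2 ⟨i.1, j.1, k.1,
        fun h => hij (Subtype.ext h), fun h => hik (Subtype.ext h),
        fun h => hjk (Subtype.ext h), rfl⟩] at h3
      have h4 : 3 ≤ mult A' q := h3
      have h5 := hgen q (show 2 ≤ mult A' q by omega)
      omega
  rw [Fintype.card_coe] at hcore
  refine hcore.trans ?_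
  rw [← Set.ncard_coe_finset M, ← Set.ncard_image_of_injective _ φinj]
  apply le_of_eq
  congr 1
  apply Set.Subset.antisymm
  · rintro _ ⟨m, hm, rfl⟩
    obtain ⟨⟨i, j⟩, hij, rfl⟩ := Finset.mem_image.1 (Finset.mem_coe.1 hm)
    have hij : i ≠ j := by simpa using hij
    refine ⟨(pointOnLine_mk_right _ _ _).2 (ψ1 _), ?_⟩
    set m := μ (i, j) with hmdef
    refine ⟨Projectivization.mk ℂ (nv m (f i w0 + m * f i w1)) (nvne _ _), ?_, ?_⟩
    · have hsub : (({i.1, j.1} : Finset ProjLine) : Set ProjLine) ⊆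
          {L : ProjLine | L ∈ A' ∧ PointOnLine
            (Projectivization.mk ℂ (nv m (f i w0 + m * f i w1)) (nvne _ _)) L} := by
        intro L hL
        simp only [Finset.coe_insert, Finset.coe_singleton, Set.mem_insert_iff,
          Set.mem_singleton_iff] at hL
        rcases hL with rfl | rfl
        · exact ⟨i.2, nvL _ _ i rfl⟩
        · exact ⟨j.2, nvL _ _ j (hμ i j hij).symm⟩
      have h3 := Set.ncard_le_ncard hsub (hfin _)
      rwa [Set.ncard_coe_finset, Finset.card_pair (fun h => hij (Subtype.ext h))] at h3
    · rw [pointOnLine_mk_right]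
      obtain ⟨c, hcc⟩ := Projectivization.exists_smul_eq_mk_rep ℂ
        (nv m (f i w0 + m * f i w1)) (nvne _ _)
      rw [← hcc, Units.smul_def, map_smul]
      simp only [nv, map_sub, map_add, map_smul, smul_eq_mul, ψ0, ψ1, ψ2]
      ring
  · rintro L ⟨hpL, q, hq, hqL⟩
    obtain ⟨I, hI, J, hJ, hIJ⟩ := (Set.one_lt_ncard (hfin q)).1 hq
    let i : A' := ⟨I, hI.1⟩
    let j : A' := ⟨J, hJ.1⟩
    have hij : i ≠ j := fun h => hIJ (congrArg Subtype.val h)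
    have hi : f i q.rep = 0 := (hf0 i _).2 hI.2
    have hj : f j q.rep = 0 := (hf0 j _).2 hJ.2
    have hqe := hexp q.rep
    set x := B.coord 0 q.rep
    set y := B.coord 1 q.rep
    set z := B.coord 2 q.rep
    have hpL' : L.rep p.rep = 0 := hpL
    have hqL' : L.rep q.rep = 0 := hqL
    have hq0 := q.rep_nonzero
    rw [hqe] at hi hj hqL' hq0
    simp only [map_add, map_smul, smul_eq_mul, hfp, hpL'] at hi hj hqL'
    have hane : f i w1 - f j w1 ≠ 0 := fun h => hij (ha (sub_eq_zero.1 h))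
    have hx : x ≠ 0 := by
      intro hx
      rw [hx] at hi hj hq0
      have hz : z * (f i w1 - f j w1) = 0 := by linear_combination hi - hj
      have hz : z = 0 := (mul_eq_zero.1 hz).resolve_right hane
      rw [hz] at hi hq0
      have hy : y = 0 := by linear_combination hi
      rw [hy] at hq0
      simp at hq0
    have hm : μ (i, j) = z / x := by
      have h := hμ i j hij
      rw [eq_div_iff hx]
      apply mul_right_cancel₀ hane
      linear_combination x * h - hi + hj
    refine ⟨μ (i, j), Finset.mem_coe.2 (Finset.mem_image_of_mem _ (by simpa using hij)), ?_⟩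
    have hmx : μ (i, j) * x = z := by rw [hm, div_mul_cancel₀ _ hx]
    have hL0 : L.rep w0 = -μ (i, j) * L.rep w1 := by
      apply mul_left_cancel₀ hx
      linear_combination hqL' - L.rep w1 * (-hmx)
    have hLψ : L.rep = L.rep w1 • ψ (μ (i, j)) := by
      refine LinearMap.ext fun v => ?_
      rw [hexp v]
      simp only [map_add, map_smul, smul_eq_mul, LinearMap.smul_apply, ψ0, ψ1, ψ2, hpL', hL0]
      ring
    rw [← Projectivization.mk_rep L]
    symm
    rw [Projectivization.mk_eq_mk_iff']
    exact ⟨_, hLψ.symm⟩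

end
end
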